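/- arXiv:1204.6261 — 9 statements merged into one kernel-verified Lean document; each statement's English description precedes it below -/
import Mathlib

section
/- For every x ≥ 0 and every u ≤ 0, one has ‖T(x) − T(u)‖ ≥ ‖T(u)‖ · √(1 − ‖T(x)‖²). -/
/-- The inverse stereographic projection onto the circle of radius 1/2 centered at (0,1/2),
realized in `ℂ ≅ ℝ²` (with the Euclidean norm). -/
noncomputable def T (x : ℝ) : ℂ := ⟨x / (1 + x ^ 2), x ^ 2 / (1 + x ^ 2)⟩

theorem norm_T_sq (x : ℝ) : ‖T x‖ ^ 2 = x ^ 2 / (1 + x ^ 2) := by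
  have hx : 1 + x ^ 2 ≠ 0 := by positivity
  rw [Complex.sq_norm, Complex.normSq_apply]
  simp only [T]
  field_simp

theorem norm_T_sub_T_sq (x u : ℝ) :
    ‖T x - T u‖ ^ 2 = (x - u) ^ 2 / ((1 + x ^ 2) * (1 + u ^ 2)) := by
  have hx : 1 + x ^ 2 ≠ 0 := by positivity
  have hu : 1 + u ^ 2 ≠ 0 := by positivity
  rw [Complex.sq_norm, Complex.normSq_apply]
  simp only [T, Complex.sub_re, Complex.sub_im]
  field_simp
  ring

theorem stmt2 (x u : ℝ) (hx : 0 ≤ x) (hu : u ≤ 0) :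
    ‖T x - T u‖ ≥ ‖T u‖ * Real.sqrt (1 - ‖T x‖ ^ 2) := by
  have hT : 1 - ‖T x‖ ^ 2 = 1 / (1 + x ^ 2) := by
    have hx' : 1 + x ^ 2 ≠ 0 := by positivity
    rw [norm_T_sq]
    field_simp
    ring
  refine le_of_pow_le_pow_left₀ two_ne_zero (norm_nonneg _) ?_
  rw [mul_pow, hT, Real.sq_sqrt (by positivity), norm_T_sq, norm_T_sub_T_sq, div_mul_div_comm,
    mul_one, mul_comm (1 + u ^ 2)]
  gcongr ?_ / _
  nlinarith [mul_nonneg hx (neg_nonneg.2 hu)]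
end

section
/- For every a > 0 there exists a real constant C such that for all x ≥ 0 and all u < 0, one has 2·(x − 2√(ax) − (3/4)·log(1+x²)) + log ‖T(x) − T(u)‖ − log ‖T(u)‖ ≥ C. -/
theorem norm_T_sub_T (x y : ℝ) :
    ‖T x - T y‖ = |x - y| / (√(1 + x ^ 2) * √(1 + y ^ 2)) := by
  have hx : 0 < 1 + x ^ 2 := by positivity
  have hy : 0 < 1 + y ^ 2 := by positivity
  rw [← sq_eq_sq₀ (norm_nonneg _) (by positivity), Complex.sq_norm, Complex.normSq_apply,
    div_pow, mul_pow, sq_abs, Real.sq_sqrt hx.le, Real.sq_sqrt hy.le]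
  simp only [T, Complex.sub_re, Complex.sub_im]
  field_simp
  ring

theorem T_zero : T 0 = 0 := by
  apply Complex.ext <;> simp [T]

theorem norm_T (x : ℝ) : ‖T x‖ = |x| / √(1 + x ^ 2) := by
  simpa [T_zero] using norm_T_sub_T x 0

theorem log_norm_T_sub_T_ge {x u : ℝ} (hx : 0 ≤ x) (hu : u < 0) :
    Real.log ‖T u‖ - 1 / 2 * Real.log (1 + x ^ 2) ≤ Real.log ‖T x - T u‖ := by
  have hsx : 0 < √(1 + x ^ 2) := by positivity
  have hsu : 0 < √(1 + u ^ 2) := by positivity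
  have hxu : 0 < x - u := by linarith
  have hlog : Real.log (-u) ≤ Real.log (x - u) :=
    Real.log_le_log (by linarith) (by linarith)
  rw [norm_T_sub_T, norm_T, abs_of_neg hu, abs_of_pos hxu,
    Real.log_div hxu.ne' (mul_pos hsx hsu).ne', Real.log_div (by linarith) hsu.ne',
    Real.log_mul hsx.ne' hsu.ne', Real.log_sqrt (x := 1 + x ^ 2) (by positivity)]
  linarith

theorem two_mul_log_one_add_sq_le {x : ℝ} (hx : 0 ≤ x) :
    2 * Real.log (1 + x ^ 2) ≤ x - 3 + 4 * Real.log 4 := by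
  have hsq : Real.log (1 + x ^ 2) ≤ 2 * Real.log (1 + x) := by
    rw [show 2 * Real.log (1 + x) = Real.log ((1 + x) ^ 2) by simp [Real.log_pow]]
    exact Real.log_le_log (by positivity) (by nlinarith)
  have hlin := Real.log_le_sub_one_of_pos (show 0 < (1 + x) / 4 by positivity)
  rw [Real.log_div (by positivity) (by norm_num)] at hlin
  linarith

theorem stmt7 (a : ℝ) (ha : 0 < a) :
    ∃ C : ℝ, ∀ x : ℝ, 0 ≤ x → ∀ u : ℝ, u < 0 →
      C ≤ 2 * (x - 2 * Real.sqrt (a * x) - (3 / 4) * Real.log (1 + x ^ 2))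
          + Real.log ‖T x - T u‖ - Real.log ‖T u‖ := by
  refine ⟨3 - 4 * Real.log 4 - 4 * a, fun x hx u hu => ?_⟩
  have hsqrt : 4 * √(a * x) ≤ x + 4 * a := by
    rw [Real.sqrt_mul ha.le]
    nlinarith [sq_nonneg (√x - 2 * √a), Real.sq_sqrt ha.le, Real.sq_sqrt hx]
  linarith [log_norm_T_sub_T_ge hx hu, two_mul_log_one_add_sq_le hx]
end

section
/- Let a > 0 and let (j_k)_{k≥0} be a strictly increasing sequence of real numbers with j_0 > 0 and inf_{k≥0} (j_{k+1} − j_k) > 0. Then there exists a constant C > 0 such that for every integer N ≥ 1, (1/N) · ∑_{k ≥ 0, j_k ≤ 2√a·N} ( log( (j_k/(2√a·N))² ) )² ≤ C. -/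
theorem sum_inv_sqrt_succ_le (M : ℕ) :
    ∑ k ∈ Finset.range M, 1 / √((k : ℝ) + 1) ≤ 2 * √(M : ℝ) := by
  induction M with
  | zero => simp
  | succ n ih =>
    rw [Finset.sum_range_succ]
    push_cast
    have hs : 0 < √((n : ℝ) + 1) := Real.sqrt_pos.2 (by positivity)
    have hs2 : √((n : ℝ) + 1) ^ 2 = n + 1 := Real.sq_sqrt (by positivity)
    have ht2 : √(n : ℝ) ^ 2 = n := Real.sq_sqrt (by positivity)
    have key : 1 / √((n : ℝ) + 1) ≤ 2 * (√((n : ℝ) + 1) - √(n : ℝ)) := by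
      rw [div_le_iff₀ hs]
      nlinarith [sq_nonneg (√((n : ℝ) + 1) - √(n : ℝ))]
    linarith

theorem sq_log_sq_le_sqrt_inv {x : ℝ} (hx : 0 < x) (hx1 : x ≤ 1) :
    Real.log (x ^ 2) ^ 2 ≤ 64 * √(x⁻¹) := by
  have hinv : 1 ≤ √(x⁻¹) := Real.one_le_sqrt.2 ((one_le_inv₀ hx).2 hx1)
  have hy1 : 1 ≤ √√(x⁻¹) := Real.one_le_sqrt.2 hinv
  have hlog : Real.log √√(x⁻¹) = -Real.log x / 4 := by
    rw [Real.log_sqrt (by positivity), Real.log_sqrt (by positivity), Real.log_inv]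
    ring
  have hle : Real.log √√(x⁻¹) ≤ √√(x⁻¹) := Real.log_le_self (by positivity)
  have hnn : 0 ≤ Real.log √√(x⁻¹) := Real.log_nonneg hy1
  have hsq : √√(x⁻¹) ^ 2 = √(x⁻¹) := Real.sq_sqrt (by positivity)
  have hpow : Real.log √√(x⁻¹) ^ 2 ≤ √√(x⁻¹) ^ 2 := pow_le_pow_left₀ hnn hle 2
  rw [hsq, hlog] at hpow
  rw [Real.log_pow]
  push_cast
  nlinarith

theorem exists_linear_lower_bound_of_gap {j : ℕ → ℝ} (h0 : 0 < j 0)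
    (hgap : ∃ d > 0, ∀ k : ℕ, d ≤ j (k + 1) - j k) :
    ∃ δ > 0, ∀ k : ℕ, δ * ((k : ℝ) + 1) ≤ j k := by
  obtain ⟨d, hd, hgap⟩ := hgap
  refine ⟨min d (j 0), lt_min hd h0, fun k => ?_⟩
  induction k with
  | zero => simp
  | succ n ih =>
    push_cast
    linarith [hgap n, min_le_left d (j 0)]

theorem tsum_sq_log_sq_le {j : ℕ → ℝ} {δ L : ℝ} (hδ : 0 < δ) (hL : 0 < L)
    (hj : ∀ k : ℕ, δ * ((k : ℝ) + 1) ≤ j k) :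
    ∑' k : ℕ, (if j k ≤ L then Real.log ((j k / L) ^ 2) ^ 2 else 0) ≤ 128 * (L / δ) := by
  have hr : 0 ≤ L / δ := by positivity
  rw [tsum_eq_sum (s := Finset.range ⌊L / δ⌋₊)]
  · calc _ ≤ ∑ k ∈ Finset.range ⌊L / δ⌋₊, 64 * √(L / δ) * (1 / √((k : ℝ) + 1)) := by
          refine Finset.sum_le_sum fun k _ => ?_
          split_ifs with hk
          · have hpos : 0 < δ * ((k : ℝ) + 1) := by positivity
            have hjk : 0 < j k := hpos.trans_le (hj k)
            refine (sq_log_sq_le_sqrt_inv (div_pos hjk hL) ((div_le_one hL).2 hk)).trans ?_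
            rw [mul_assoc, mul_one_div, ← Real.sqrt_div hr, inv_div, div_div]
            gcongr
            exact hj k
          · positivity
      _ ≤ 64 * √(L / δ) * (2 * √(⌊L / δ⌋₊ : ℝ)) := by
          rw [← Finset.mul_sum]
          gcongr
          exact sum_inv_sqrt_succ_le _
      _ ≤ 64 * √(L / δ) * (2 * √(L / δ)) := by
          gcongr
          exact Nat.floor_le hr
      _ = 128 * (L / δ) := by
          linear_combination 128 * Real.mul_self_sqrt hr
  · intro k hk
    rw [Finset.mem_range, not_lt] at hk
    have hlt : L / δ < (k : ℝ) + 1 := by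
      exact_mod_cast (Nat.floor_lt hr).1 (Nat.lt_succ_of_le hk)
    rw [div_lt_iff₀ hδ] at hlt
    exact if_neg (by linarith [hj k])

theorem stmt10 (a : ℝ) (ha : 0 < a) (j : ℕ → ℝ) (hmono : StrictMono j) (h0 : 0 < j 0)
    (hgap : ∃ d > 0, ∀ k : ℕ, d ≤ j (k + 1) - j k) :
    ∃ C > 0, ∀ N : ℕ, 1 ≤ N →
      (1 / N : ℝ) * ∑' k : ℕ,
          (if j k ≤ 2 * Real.sqrt a * N then
            (Real.log ((j k / (2 * Real.sqrt a * N)) ^ 2)) ^ 2 else 0)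
        ≤ C := by
  obtain ⟨δ, hδ, hj⟩ := exists_linear_lower_bound_of_gap h0 hgap
  have hs : 0 < √a := Real.sqrt_pos.2 ha
  refine ⟨256 * √a / δ, by positivity, fun N hN => ?_⟩
  have hN0 : (0 : ℝ) < N := by exact_mod_cast hN
  calc _ ≤ (1 / N : ℝ) * (128 * (2 * √a * N / δ)) := by
        gcongr
        exact tsum_sq_log_sq_le hδ (by positivity) hj
    _ = 256 * √a / δ := by
        field_simp
        norm_num
end

section
/- Let m ≥ 1 and N = 2m. Let x_1, …, x_N and u_1, …, u_m be real numbers with x_j ≠ u_i for all i, j. Let A be the N×N matrix whose (i,j) entry is x_j^{i−1} for 1 ≤ i ≤ m, 1 ≤ j ≤ N, and whose (m+i, j) entry is x_j^i / (x_j − u_i) for 1 ≤ i ≤ m, 1 ≤ j ≤ N; let B be the N×N matrix with the same first m rows as A and with (m+i, j) entry 1/(x_j − u_i) for 1 ≤ i ≤ m, 1 ≤ j ≤ N. Then det A = (∏_{i=1}^m u_i^i) · det B. -/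
/-- Division with remainder of `y ^ (i + 1)` by `y - v`, with the quotient padded to `m` terms. -/
theorem pow_succ_div_sub_eq {K : Type*} [Field K] {m : ℕ} (i : Fin m) {y v : K} (h : y ≠ v) :
    y ^ ((i : ℕ) + 1) / (y - v) =
      (∑ k : Fin m, (if (k : ℕ) ≤ i then v ^ ((i : ℕ) - k) else 0) * y ^ (k : ℕ)) +
        v ^ ((i : ℕ) + 1) * (1 / (y - v)) := by
  have hsub : y - v ≠ 0 := sub_ne_zero.mpr h
  have hsum : (∑ k : Fin m, (if (k : ℕ) ≤ i then v ^ ((i : ℕ) - k) else 0) * y ^ (k : ℕ)) =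
      ∑ k ∈ Finset.range ((i : ℕ) + 1), y ^ k * v ^ ((i : ℕ) + 1 - 1 - k) := by
    rw [Fin.sum_univ_eq_sum_range
      (fun k => (if k ≤ (i : ℕ) then v ^ ((i : ℕ) - k) else 0) * y ^ k) m]
    symm
    refine Finset.sum_subset_zero_on_sdiff (Finset.range_subset_range.mpr i.isLt) ?_ ?_
    · intro k hk
      have hk' : ¬ k ≤ (i : ℕ) := by
        simp only [Finset.mem_sdiff, Finset.mem_range] at hk
        omega
      simp [hk']
    · intro k hk
      have hk' : k ≤ (i : ℕ) := by
        simp only [Finset.mem_range] at hk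
        omega
      simp [hk', mul_comm]
  have hgeom := geom_sum₂_mul y v ((i : ℕ) + 1)
  rw [hsum]
  field_simp
  linear_combination -hgeom

theorem stmt11 (m : ℕ) (hm : 1 ≤ m) (x : Fin (2 * m) → ℝ) (u : Fin m → ℝ)
    (hxu : ∀ (i : Fin m) (j : Fin (2 * m)), x j ≠ u i) :
    Matrix.det (Matrix.of fun i j : Fin (2 * m) =>
        if (i : ℕ) < m then x j ^ (i : ℕ)
        else x j ^ ((i : ℕ) - m + 1) / (x j - u ⟨(i : ℕ) - m, by have := i.isLt; omega⟩)) =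
      (∏ i : Fin m, u i ^ ((i : ℕ) + 1)) *
        Matrix.det (Matrix.of fun i j : Fin (2 * m) =>
          if (i : ℕ) < m then x j ^ (i : ℕ)
          else 1 / (x j - u ⟨(i : ℕ) - m, by have := i.isLt; omega⟩)) := by
  let e : Fin m ⊕ Fin m ≃ Fin (2 * m) := finSumFinEquiv.trans (finCongr (two_mul m).symm)
  have hl (i : Fin m) : (e (Sum.inl i) : ℕ) = i := by simp [e]
  have hr (i : Fin m) : (e (Sum.inr i) : ℕ) = m + i := by simp [e, add_comm]
  let P : Matrix (Fin m) (Fin m) ℝ :=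
    Matrix.of fun i k => if (k : ℕ) ≤ i then u i ^ ((i : ℕ) - k) else 0
  let D : Matrix (Fin m) (Fin m) ℝ := Matrix.diagonal fun i => u i ^ ((i : ℕ) + 1)
  have hdet : (Matrix.fromBlocks 1 0 P D).det = ∏ i : Fin m, u i ^ ((i : ℕ) + 1) := by
    simp [D, Matrix.det_fromBlocks_zero₁₂]
  rw [← hdet, ← Matrix.det_submatrix_equiv_self e,
    ← Matrix.det_submatrix_equiv_self e (Matrix.of _),
    ← Matrix.det_mul]
  congr 1
  ext i j
  rw [Matrix.mul_apply, Fintype.sum_sum_type]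
  rcases i with i | i
  · simp [hl, Matrix.one_apply]
  · simp only [P, D]
    simpa [Matrix.diagonal_apply, hl, hr] using pow_succ_div_sub_eq i (hxu i (e j))
end

section
/- For every δ > 0 and every integer N ≥ 1, the integral over the ordered simplex satisfies ∫_{{x ∈ ℝ^N : 0 ≤ x_1 < x_2 < ⋯ < x_N ≤ δ}} ∏_{i=1}^{N−1} (x_{i+1} − x_i) dx_1 ⋯ dx_N ≥ (1/2^{N−1}) · (δ/N)^{2N−1}. -/
open MeasureTheory

/-- The lower triangular matrix of ones, which sends a vector to its partial sums. -/
def partialSumMatrix (n : ℕ) : Matrix (Fin n) (Fin n) ℝ :=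
  Matrix.of fun i j => if j ≤ i then 1 else 0

theorem partialSumMatrix_mulVec {n : ℕ} (y : Fin n → ℝ) (i : Fin n) :
    (partialSumMatrix n).mulVec y i = ∑ j ∈ Finset.Iic i, y j := by
  simp only [partialSumMatrix, Matrix.mulVec, dotProduct, Matrix.of_apply, ite_mul, one_mul,
    zero_mul, ← Finset.sum_filter]
  congr 1
  ext j
  simp

theorem det_partialSumMatrix (n : ℕ) : (partialSumMatrix n).det = 1 := by
  rw [Matrix.det_of_isLowerTriangular]
  · simp [partialSumMatrix]
  · intro i j hij
    simpa [partialSumMatrix] using hij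

theorem measurePreserving_partialSumMatrix (n : ℕ) :
    MeasurePreserving (partialSumMatrix n).mulVec := by
  have h := Real.map_matrix_volume_pi_eq_smul_volume_pi (M := partialSumMatrix n)
    (by simp [det_partialSumMatrix])
  refine ⟨(Continuous.matrix_mulVec continuous_const continuous_id).measurable, ?_⟩
  rw [det_partialSumMatrix, inv_one, abs_one, ENNReal.ofReal_one, one_smul] at h
  exact h

theorem measurableEmbedding_partialSumMatrix (n : ℕ) :
    MeasurableEmbedding (partialSumMatrix n).mulVec := by
  have hcont : Continuous (partialSumMatrix n).mulVec :=
    Continuous.matrix_mulVec continuous_const continuous_id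
  refine hcont.measurableEmbedding ?_
  rw [Matrix.mulVec_injective_iff_isUnit, Matrix.isUnit_iff_isUnit_det, det_partialSumMatrix]
  exact isUnit_one

theorem partialSumMatrix_mulVec_zero {n : ℕ} (y : Fin (n + 1) → ℝ) :
    (partialSumMatrix (n + 1)).mulVec y 0 = y 0 := by
  rw [partialSumMatrix_mulVec, show Finset.Iic (0 : Fin (n + 1)) = {0} by ext j; simp]
  simp

theorem partialSumMatrix_mulVec_last {n : ℕ} (y : Fin (n + 1) → ℝ) :
    (partialSumMatrix (n + 1)).mulVec y (Fin.last n) = ∑ i, y i := by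
  rw [partialSumMatrix_mulVec]
  congr 1
  ext j
  simp [Fin.le_last]

theorem partialSumMatrix_mulVec_succ {n : ℕ} (y : Fin (n + 1) → ℝ) (i : Fin n) :
    (partialSumMatrix (n + 1)).mulVec y i.succ =
      (partialSumMatrix (n + 1)).mulVec y i.castSucc + y i.succ := by
  have h : Finset.Iic i.succ = insert i.succ (Finset.Iic i.castSucc) := by
    ext j
    simp only [Finset.mem_Iic, Finset.mem_insert, Fin.le_def, Fin.ext_iff, Fin.val_succ,
      Fin.val_castSucc]
    omega
  rw [partialSumMatrix_mulVec, partialSumMatrix_mulVec, h, Finset.sum_insert, add_comm]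
  simp [Fin.le_def]

theorem setIntegral_cube_prod_succ {ε : ℝ} (hε : 0 ≤ ε) (n : ℕ) :
    ∫ y in Set.univ.pi fun _ : Fin (n + 1) => Set.Ioc 0 ε, ∏ i : Fin n, y i.succ =
      ε * (ε ^ 2 / 2) ^ n := by
  let g : Fin (n + 1) → ℝ → ℝ := Fin.cons (fun _ => 1) fun _ t => t
  have hg : ∀ y : Fin (n + 1) → ℝ, ∏ i : Fin n, y i.succ = ∏ i, g i (y i) := fun y => by
    simp [Fin.prod_univ_succ, g]
  simp_rw [hg]
  rw [volume_pi, Measure.restrict_pi_pi, integral_fintype_prod_eq_prod, Fin.prod_univ_succ]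
  have h : ∫ t in Set.Ioc 0 ε, t = ε ^ 2 / 2 := by
    rw [← intervalIntegral.integral_of_le hε, integral_id]
    ring
  simp [g, h, hε, div_pow]

theorem stmt12 (δ : ℝ) (hδ : 0 < δ) (n : ℕ) :
    (1 / 2 ^ n : ℝ) * (δ / (n + 1 : ℝ)) ^ (2 * (n + 1) - 1) ≤
      ∫ x in {x : Fin (n + 1) → ℝ | 0 ≤ x 0 ∧ x (Fin.last n) ≤ δ ∧ StrictMono x},
        ∏ i : Fin n, (x i.succ - x i.castSucc) := by
  set ε : ℝ := δ / (n + 1) with hε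
  have hε0 : 0 ≤ ε := by positivity
  rw [← (measurePreserving_partialSumMatrix (n + 1)).setIntegral_preimage_emb
    (measurableEmbedding_partialSumMatrix (n + 1))]
  have hS : (partialSumMatrix (n + 1)).mulVec ⁻¹'
      {x : Fin (n + 1) → ℝ | 0 ≤ x 0 ∧ x (Fin.last n) ≤ δ ∧ StrictMono x} =
      {y | 0 ≤ y 0 ∧ ∑ i, y i ≤ δ ∧ ∀ i : Fin n, 0 < y i.succ} := by
    ext y
    simp [Fin.strictMono_iff_lt_succ, partialSumMatrix_mulVec_zero,
      partialSumMatrix_mulVec_last, partialSumMatrix_mulVec_succ]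
  simp only [hS, partialSumMatrix_mulVec_succ, add_sub_cancel_left]
  have hmeas : MeasurableSet
      {y : Fin (n + 1) → ℝ | 0 ≤ y 0 ∧ ∑ i, y i ≤ δ ∧ ∀ i : Fin n, 0 < y i.succ} := by
    measurability
  have hcont : Continuous fun y : Fin (n + 1) → ℝ => ∏ i : Fin n, y i.succ := by fun_prop
  calc (1 / 2 ^ n : ℝ) * ε ^ (2 * (n + 1) - 1) = ε * (ε ^ 2 / 2) ^ n := by
        rw [show 2 * (n + 1) - 1 = 2 * n + 1 by omega, div_pow (ε ^ 2), ← pow_mul]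
        ring
    _ = _ := (setIntegral_cube_prod_succ hε0 n).symm
    _ ≤ _ := by
      refine setIntegral_mono_set ?_ ?_ (LE.le.eventuallyLE ?_)
      · refine (hcont.continuousOn.integrableOn_compact
          (isCompact_Icc (a := (0 : Fin (n + 1) → ℝ)) (b := fun _ => δ))).mono_set ?_
        rintro y ⟨h0, hsum, hpos⟩
        have hy : 0 ≤ y := fun i => Fin.cases h0 (fun j => (hpos j).le) i
        exact ⟨hy, fun i =>
          (Finset.single_le_sum (fun j _ => hy j) (Finset.mem_univ i)).trans hsum⟩
      · filter_upwards [ae_restrict_mem hmeas] with y hy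
        exact Finset.prod_nonneg fun i _ => (hy.2.2 i).le
      · intro y hy
        rw [Set.mem_univ_pi] at hy
        refine ⟨(hy 0).1.le, ?_, fun i => (hy i.succ).1⟩
        calc ∑ i, y i ≤ ∑ _i : Fin (n + 1), ε := Finset.sum_le_sum fun i _ => (hy i).2
          _ = δ := by
            simp only [Finset.sum_const, Finset.card_univ, Fintype.card_fin, nsmul_eq_mul, hε]
            push_cast
            field_simp
end

section
/- Let α ≥ 0, a > 0 and L > 0. Then there exists N₀ ∈ ℕ such that for every integer N ≥ N₀ and every y ∈ [0, 2N√(aL)], one has y^α · I_α(y) · e^{−y} ≤ (2N√a)^α. -/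
/-- The modified Bessel function of the first kind
`I_α(x) = ∑_{k=0}^∞ (x/2)^(2k+α) / (k! Γ(k+α+1))`. -/
noncomputable def besselI (α x : ℝ) : ℝ :=
  ∑' k : ℕ, (x / 2) ^ (2 * (k : ℝ) + α) / (Nat.factorial k * Real.Gamma ((k : ℝ) + α + 1))

open MeasureTheory Set in
/-- If `s ^ x * exp (-s) ≥ m` on `[p, q]`, then `Γ(x + 1)` is at least `(q - p) * m`. -/
theorem mul_le_Gamma_add_one {x p q m : ℝ} (hx : 0 ≤ x) (hp : 0 ≤ p) (hpq : p ≤ q)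
    (hm : ∀ s ∈ Ioc p q, m ≤ s ^ x * Real.exp (-s)) :
    (q - p) * m ≤ Real.Gamma (x + 1) := by
  have hint : IntegrableOn (fun s : ℝ => Real.exp (-s) * s ^ (x + 1 - 1)) (Ioi 0) :=
    Real.GammaIntegral_convergent (by linarith)
  have hsub : Ioc p q ⊆ Ioi (0 : ℝ) := fun s hs => lt_of_le_of_lt hp hs.1
  rw [Real.Gamma_eq_integral (by linarith)]
  calc (q - p) * m = ∫ _ in Ioc p q, m := by
        simp [hpq]
    _ ≤ ∫ s in Ioc p q, Real.exp (-s) * s ^ (x + 1 - 1) := by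
        refine setIntegral_mono_on (by simp) (hint.mono_set hsub)
          measurableSet_Ioc fun s hs => ?_
        simpa [mul_comm] using hm s hs
    _ ≤ ∫ s in Ioi 0, Real.exp (-s) * s ^ (x + 1 - 1) := by
        refine setIntegral_mono_set hint ?_ hsub.eventuallyLE
        filter_upwards [ae_restrict_mem measurableSet_Ioi] with s hs
        have : (0 : ℝ) < s := hs
        positivity

theorem rpow_le_exp_one_mul_exp_mul_Gamma {t x : ℝ} (ht : 0 ≤ t) (hx : 0 ≤ x) :
    t ^ x ≤ Real.exp 1 * Real.exp t * Real.Gamma (x + 1) := by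
  have h := mul_le_Gamma_add_one (m := t ^ x * Real.exp (-(t + 1))) hx ht
    (by linarith : t ≤ t + 1) fun s hs => by
      have hs0 : 0 ≤ s := ht.trans hs.1.le
      gcongr
      exacts [hs.1.le, hs.2]
  have he : Real.exp 1 * Real.exp t * Real.exp (-(t + 1)) = 1 := by
    rw [← Real.exp_add, ← Real.exp_add]; simp; ring
  calc t ^ x = Real.exp 1 * Real.exp t * ((t + 1 - t) * (t ^ x * Real.exp (-(t + 1)))) := by
        linear_combination -(t ^ x) * he
    _ ≤ _ := by gcongr

theorem exp_neg_two_mul_le_rpow_mul_exp_neg {t x s : ℝ} (ht : 0 < t) (hs : t / 2 ≤ s)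
    (hst : (s - t) ^ 2 ≤ t) (hxs : 0 ≤ (x - t) * (s - t)) :
    Real.exp (-2) * (t ^ x * Real.exp (-t)) ≤ s ^ x * Real.exp (-s) := by
  have hs0 : 0 < s := by linarith
  rw [Real.rpow_def_of_pos ht, Real.rpow_def_of_pos hs0, ← Real.exp_add, ← Real.exp_add,
    ← Real.exp_add, Real.exp_le_exp]
  have hlog : Real.log s - Real.log t = Real.log (s / t) := (Real.log_div hs0.ne' ht.ne').symm
  have h1 : 1 - t / s ≤ Real.log (s / t) := by
    simpa using Real.one_sub_inv_le_log_of_pos (div_pos hs0 ht)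
  have h2 : t * Real.log (s / t) ≤ x * Real.log (s / t) := by
    rcases lt_trichotomy s t with h | h | h
    · have : Real.log (s / t) ≤ 0 :=
        Real.log_nonpos (by positivity) ((div_le_one ht).2 h.le)
      have : x ≤ t := by nlinarith
      nlinarith
    · simp [h, ht.ne']
    · have : 0 ≤ Real.log (s / t) := Real.log_nonneg ((one_le_div ht).2 h.le)
      have : t ≤ x := by nlinarith
      nlinarith
  have h3 : -2 ≤ t * (1 - t / s) - (s - t) := by
    have : t * (1 - t / s) - (s - t) = -((s - t) ^ 2 / s) := by field_simp; ring
    rw [this, neg_le_neg_iff, div_le_iff₀ hs0]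
    linarith
  have h4 := mul_le_mul_of_nonneg_left h1 ht.le
  rw [← hlog] at h2 h4
  linarith

theorem sqrt_mul_rpow_le_exp_two_mul_exp_mul_Gamma {t x : ℝ} (ht : 4 ≤ t) (hx : 0 ≤ x) :
    Real.sqrt t * t ^ x ≤ Real.exp 2 * Real.exp t * Real.Gamma (x + 1) := by
  have hsq : Real.sqrt t ^ 2 = t := Real.sq_sqrt (by linarith)
  have h2 : 2 ≤ Real.sqrt t := Real.le_sqrt_of_sq_le (by linarith)
  have h : Real.sqrt t * (Real.exp (-2) * (t ^ x * Real.exp (-t))) ≤ Real.Gamma (x + 1) := by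
    rcases le_total t x with htx | htx
    · have := mul_le_Gamma_add_one (m := Real.exp (-2) * (t ^ x * Real.exp (-t))) hx
        (by linarith : 0 ≤ t) (by linarith : t ≤ t + Real.sqrt t) fun s hs =>
          exp_neg_two_mul_le_rpow_mul_exp_neg (by linarith) (by linarith [hs.1])
            (by nlinarith [hs.1, hs.2]) (mul_nonneg (by linarith) (by linarith [hs.1]))
      simpa using this
    · have := mul_le_Gamma_add_one (m := Real.exp (-2) * (t ^ x * Real.exp (-t))) hx
        (by nlinarith : 0 ≤ t - Real.sqrt t) (by linarith : t - Real.sqrt t ≤ t) fun s hs =>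
          exp_neg_two_mul_le_rpow_mul_exp_neg (by linarith) (by nlinarith [hs.1])
            (by nlinarith [hs.1, hs.2])
            (mul_nonneg_of_nonpos_of_nonpos (by linarith) (by linarith [hs.2]))
      simpa using this
  have he : Real.exp 2 * Real.exp (-2) = 1 := by rw [← Real.exp_add]; simp
  have he' : Real.exp t * Real.exp (-t) = 1 := by rw [← Real.exp_add]; simp
  calc Real.sqrt t * t ^ x
      = Real.exp 2 * Real.exp t * (Real.sqrt t * (Real.exp (-2) * (t ^ x * Real.exp (-t)))) := by
        linear_combination -(Real.sqrt t * t ^ x) * (he + Real.exp 2 * Real.exp (-2) * he')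
    _ ≤ _ := by gcongr

/-- Bounding the factor `(y / 2) ^ (k + α) / Γ(k + α + 1)` of every term of the series by
`B * exp (y / 2)` bounds `I_α(y)` by `B * exp y`. -/
theorem besselI_mul_exp_neg_le {α y B : ℝ} (hα : 0 ≤ α) (hy : 0 ≤ y)
    (h : ∀ k : ℕ, (y / 2) ^ ((k : ℝ) + α) ≤
      B * Real.exp (y / 2) * Real.Gamma ((k : ℝ) + α + 1)) :
    besselI α y * Real.exp (-y) ≤ B := by
  have hsum : HasSum (fun k : ℕ => (y / 2) ^ k / (Nat.factorial k : ℝ) * (B * Real.exp (y / 2)))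
      (Real.exp (y / 2) * (B * Real.exp (y / 2))) := by
    refine HasSum.mul_right _ ?_
    rw [Real.exp_eq_exp_ℝ]
    exact NormedSpace.expSeries_div_hasSum_exp (y / 2)
  have hG (k : ℕ) : 0 < Real.Gamma ((k : ℝ) + α + 1) := Real.Gamma_pos_of_pos (by positivity)
  have hterm (k : ℕ) : (y / 2) ^ (2 * (k : ℝ) + α) /
      (Nat.factorial k * Real.Gamma ((k : ℝ) + α + 1)) ≤
      (y / 2) ^ k / (Nat.factorial k : ℝ) * (B * Real.exp (y / 2)) := by
    have hsplit : (y / 2) ^ (2 * (k : ℝ) + α) = (y / 2) ^ k * (y / 2) ^ ((k : ℝ) + α) := by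
      rw [← Real.rpow_natCast, ← Real.rpow_add_of_nonneg (by positivity) (by positivity)
        (by positivity)]
      ring_nf
    rw [hsplit, mul_div_mul_comm]
    gcongr
    exact (div_le_iff₀ (hG k)).2 (h k)
  have hsummable := Summable.of_nonneg_of_le
    (fun k => div_nonneg (by positivity) (mul_nonneg (by positivity) (hG k).le)) hterm hsum.summable
  have hle : besselI α y ≤ Real.exp (y / 2) * (B * Real.exp (y / 2)) :=
    (hsummable.tsum_le_tsum hterm hsum.summable).trans_eq hsum.tsum_eq
  calc besselI α y * Real.exp (-y)
      ≤ Real.exp (y / 2) * (B * Real.exp (y / 2)) * Real.exp (-y) := by gcongr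
    _ = B * (Real.exp (y / 2) * Real.exp (y / 2) * Real.exp (-y)) := by ring
    _ = B := by rw [← Real.exp_add, ← Real.exp_add]; simp

theorem besselI_zero_mul_exp_neg_le_one {y : ℝ} (hy : 0 ≤ y) :
    besselI 0 y * Real.exp (-y) ≤ 1 := by
  refine besselI_mul_exp_neg_le le_rfl hy fun k => ?_
  rw [add_zero, Real.Gamma_nat_eq_factorial, Real.rpow_natCast, one_mul,
    ← div_le_iff₀ (by positivity)]
  exact Real.pow_div_factorial_le_exp _ (by positivity) k

theorem besselI_mul_exp_neg_le_exp_one {α y : ℝ} (hα : 0 ≤ α) (hy : 0 ≤ y) :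
    besselI α y * Real.exp (-y) ≤ Real.exp 1 :=
  besselI_mul_exp_neg_le hα hy fun _ =>
    rpow_le_exp_one_mul_exp_mul_Gamma (by positivity) (by positivity)

theorem besselI_mul_exp_neg_le_div_sqrt {α y : ℝ} (hα : 0 ≤ α) (hy : 8 ≤ y) :
    besselI α y * Real.exp (-y) ≤ Real.exp 2 / Real.sqrt (y / 2) := by
  refine besselI_mul_exp_neg_le hα (by linarith) fun k => ?_
  have hpos : 0 < Real.sqrt (y / 2) := Real.sqrt_pos.2 (by linarith)
  rw [div_mul_eq_mul_div, div_mul_eq_mul_div, le_div_iff₀ hpos, mul_comm]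
  exact sqrt_mul_rpow_le_exp_two_mul_exp_mul_Gamma (by linarith) (by positivity)

theorem exists_forall_besselI_mul_exp_neg_le {α ε : ℝ} (hα : 0 ≤ α) (hε : 0 < ε) :
    ∃ Y : ℝ, 0 ≤ Y ∧ ∀ y, Y ≤ y → besselI α y * Real.exp (-y) ≤ ε := by
  refine ⟨max 8 (2 * (Real.exp 2 / ε) ^ 2), by positivity, fun y hy => ?_⟩
  have h8 : 8 ≤ y := (le_max_left _ _).trans hy
  refine (besselI_mul_exp_neg_le_div_sqrt hα h8).trans ?_
  rw [div_le_comm₀ (Real.sqrt_pos.2 (by linarith)) hε]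
  exact Real.le_sqrt_of_sq_le (by linarith [(le_max_right _ _).trans hy])

theorem stmt13 (α a L : ℝ) (hα : 0 ≤ α) (ha : 0 < a) (hL : 0 < L) :
    ∃ N₀ : ℕ, ∀ N : ℕ, N₀ ≤ N → ∀ y ∈ Set.Icc (0 : ℝ) (2 * N * Real.sqrt (a * L)),
      y ^ α * besselI α y * Real.exp (-y) ≤ (2 * N * Real.sqrt a) ^ α := by
  rcases hα.eq_or_lt with rfl | hα'
  · refine ⟨0, fun N _ y hy => ?_⟩
    simpa using besselI_zero_mul_exp_neg_le_one hy.1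
  have hsL : 0 < Real.sqrt L := Real.sqrt_pos.2 hL
  have hsa : 0 < Real.sqrt a := Real.sqrt_pos.2 ha
  obtain ⟨Y, hY0, hY⟩ := exists_forall_besselI_mul_exp_neg_le hα
    (inv_pos.2 (Real.rpow_pos_of_pos hsL α))
  have hlim : Filter.Tendsto (fun N : ℕ => (2 * (N : ℝ) * Real.sqrt a) ^ α)
      Filter.atTop Filter.atTop :=
    (tendsto_rpow_atTop hα').comp
      ((tendsto_natCast_atTop_atTop.const_mul_atTop two_pos).atTop_mul_const hsa)
  obtain ⟨N₀, hN₀⟩ := Filter.eventually_atTop.1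
    (hlim.eventually_ge_atTop (Y ^ α * Real.exp 1))
  refine ⟨N₀, fun N hN y ⟨hy0, hy⟩ => ?_⟩
  rw [mul_assoc]
  rcases le_total y Y with hyY | hyY
  · calc y ^ α * (besselI α y * Real.exp (-y)) ≤ y ^ α * Real.exp 1 := by
          gcongr
          exact besselI_mul_exp_neg_le_exp_one hα hy0
      _ ≤ Y ^ α * Real.exp 1 := by gcongr
      _ ≤ _ := hN₀ N hN
  · calc y ^ α * (besselI α y * Real.exp (-y))
        ≤ (2 * N * Real.sqrt (a * L)) ^ α * (Real.sqrt L ^ α)⁻¹ := by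
          refine (mul_le_mul_of_nonneg_left (hY y hyY) (by positivity)).trans ?_
          gcongr
      _ = (2 * N * Real.sqrt a) ^ α := by
          rw [Real.sqrt_mul ha.le, ← mul_assoc, Real.mul_rpow (by positivity) hsL.le]
          field_simp
end

section
/- For every α ≥ 0, a > 0 and every integer N ≥ 1, the function x ↦ x − (1/N)·log( x^{α/2} · I_α(2N√(ax)) ) − log(1+x²) is bounded below on (0, ∞). -/
theorem Real.Gamma_add_one_mul_factorial_le {α : ℝ} (hα : 0 ≤ α) (k : ℕ) :
    Real.Gamma (α + 1) * k.factorial ≤ Real.Gamma ((k : ℝ) + α + 1) := by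
  induction k with
  | zero => simp
  | succ k ih =>
    have hk : (0 : ℝ) ≤ k := k.cast_nonneg
    have hpos : 0 < (k : ℝ) + α + 1 := by positivity
    have hG : 0 < Real.Gamma (α + 1) := Real.Gamma_pos_of_pos (by linarith)
    rw [show ((k + 1 : ℕ) : ℝ) + α + 1 = ((k : ℝ) + α + 1) + 1 by push_cast; ring,
      Real.Gamma_add_one hpos.ne', Nat.factorial_succ]
    push_cast
    calc Real.Gamma (α + 1) * (((k : ℝ) + 1) * k.factorial)
        = ((k : ℝ) + 1) * (Real.Gamma (α + 1) * k.factorial) := by ring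
      _ ≤ ((k : ℝ) + α + 1) * Real.Gamma ((k : ℝ) + α + 1) := by
        gcongr
        linarith

theorem besselI_term_pos {α y : ℝ} (hα : 0 ≤ α) (hy : 0 < y) (k : ℕ) :
    0 < y ^ (2 * (k : ℝ) + α) / (Nat.factorial k * Real.Gamma ((k : ℝ) + α + 1)) := by
  have : 0 < Real.Gamma ((k : ℝ) + α + 1) := Real.Gamma_pos_of_pos (by positivity)
  positivity

theorem besselI_term_le {α y : ℝ} (hα : 0 ≤ α) (hy : 0 < y) (k : ℕ) :
    y ^ (2 * (k : ℝ) + α) / (Nat.factorial k * Real.Gamma ((k : ℝ) + α + 1)) ≤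
      y ^ α / Real.Gamma (α + 1) * Real.exp y * (y ^ k / k.factorial) := by
  have hG : 0 < Real.Gamma (α + 1) := Real.Gamma_pos_of_pos (by linarith)
  have hpow : y ^ (2 * (k : ℝ) + α) = y ^ α * (y ^ k * y ^ k) := by
    rw [Real.rpow_add hy, two_mul, Real.rpow_add hy, Real.rpow_natCast]
    ring
  have hexp : y ^ k / k.factorial ≤ Real.exp y := Real.pow_div_factorial_le_exp y hy.le k
  calc y ^ (2 * (k : ℝ) + α) / (Nat.factorial k * Real.Gamma ((k : ℝ) + α + 1))
      ≤ y ^ (2 * (k : ℝ) + α) / (Nat.factorial k * (Real.Gamma (α + 1) * k.factorial)) := by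
        gcongr
        exact Real.Gamma_add_one_mul_factorial_le hα k
    _ = y ^ α / Real.Gamma (α + 1) * (y ^ k / k.factorial) * (y ^ k / k.factorial) := by
        rw [hpow]
        field_simp
    _ ≤ y ^ α / Real.Gamma (α + 1) * Real.exp y * (y ^ k / k.factorial) := by gcongr

theorem summable_besselI_term {α y : ℝ} (hα : 0 ≤ α) (hy : 0 < y) :
    Summable fun k : ℕ ↦
      y ^ (2 * (k : ℝ) + α) / (Nat.factorial k * Real.Gamma ((k : ℝ) + α + 1)) :=
  .of_nonneg_of_le (fun k ↦ (besselI_term_pos hα hy k).le) (besselI_term_le hα hy)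
    ((Real.summable_pow_div_factorial y).mul_left _)

theorem besselI_pos {α x : ℝ} (hα : 0 ≤ α) (hx : 0 < x) : 0 < besselI α x :=
  (summable_besselI_term hα (half_pos hx)).tsum_pos
    (fun k ↦ (besselI_term_pos hα (half_pos hx) k).le) 0 (besselI_term_pos hα (half_pos hx) 0)

theorem besselI_le {α x : ℝ} (hα : 0 ≤ α) (hx : 0 < x) :
    besselI α x ≤ (x / 2) ^ α / Real.Gamma (α + 1) * Real.exp x := by
  have hy := half_pos hx
  calc besselI α x
      ≤ ∑' k : ℕ, (x / 2) ^ α / Real.Gamma (α + 1) * Real.exp (x / 2) *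
          ((x / 2) ^ k / k.factorial) :=
        (summable_besselI_term hα hy).tsum_le_tsum (besselI_term_le hα hy)
          ((Real.summable_pow_div_factorial _).mul_left _)
    _ = (x / 2) ^ α / Real.Gamma (α + 1) * Real.exp (x / 2) * Real.exp (x / 2) := by
        rw [tsum_mul_left, Real.exp_eq_exp_ℝ, NormedSpace.exp_eq_tsum_div]
    _ = (x / 2) ^ α / Real.Gamma (α + 1) * Real.exp x := by
        rw [mul_assoc, ← Real.exp_add, add_halves]

theorem log_besselI_le {α x : ℝ} (hα : 0 ≤ α) (hx : 0 < x) :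
    Real.log (besselI α x) ≤
      α * Real.log (x / 2) - Real.log (Real.Gamma (α + 1)) + x := by
  have hG : 0 < Real.Gamma (α + 1) := Real.Gamma_pos_of_pos (by linarith)
  have hpow : 0 < (x / 2) ^ α := Real.rpow_pos_of_pos (half_pos hx) α
  calc Real.log (besselI α x)
      ≤ Real.log ((x / 2) ^ α / Real.Gamma (α + 1) * Real.exp x) :=
        Real.log_le_log (besselI_pos hα hx) (besselI_le hα hx)
    _ = _ := by
        rw [Real.log_mul (by positivity) (by positivity), Real.log_div hpow.ne' hG.ne',
          Real.log_rpow (half_pos hx), Real.log_exp]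

theorem Real.log_le_div_add_log {x c : ℝ} (hx : 0 < x) (hc : 0 < c) :
    Real.log x ≤ x / c - 1 + Real.log c := by
  have h := Real.log_le_sub_one_of_pos (div_pos hx hc)
  rw [Real.log_div hx.ne' hc.ne'] at h
  linarith

theorem stmt14 (α a : ℝ) (hα : 0 ≤ α) (ha : 0 < a) (N : ℕ) (hN : 1 ≤ N) :
    ∃ C : ℝ, ∀ x : ℝ, 0 < x →
      C ≤ x - (1 / N : ℝ) * Real.log (x ^ (α / 2) * besselI α (2 * N * Real.sqrt (a * x)))
          - Real.log (1 + x ^ 2) := by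
  have hN0 : (0 : ℝ) < N := by exact_mod_cast hN
  set b : ℝ := α / N with hb
  have hb0 : 0 ≤ b := by positivity
  set K : ℝ := (α * (Real.log N + Real.log a / 2) - Real.log (Real.Gamma (α + 1))) / N with hK
  refine ⟨-(K + b * Real.log (4 * b + 1) + 4 * a + 2 * Real.log 8), fun x hx ↦ ?_⟩
  have hs : 0 < Real.sqrt (a * x) := Real.sqrt_pos.2 (by positivity)
  have harg : 0 < 2 * N * Real.sqrt (a * x) := by positivity
  have hlog : (1 / N : ℝ) * Real.log (x ^ (α / 2) * besselI α (2 * N * Real.sqrt (a * x))) ≤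
      b * Real.log x + K + 2 * Real.sqrt (a * x) := by
    have hI := log_besselI_le hα harg
    rw [show 2 * N * Real.sqrt (a * x) / 2 = N * Real.sqrt (a * x) by ring,
      Real.log_mul hN0.ne' hs.ne', Real.log_sqrt (by positivity),
      Real.log_mul ha.ne' hx.ne'] at hI
    rw [Real.log_mul (Real.rpow_pos_of_pos hx _).ne' (besselI_pos hα harg).ne',
      Real.log_rpow hx, one_div_mul_eq_div, div_le_iff₀ hN0]
    have hcancel : (b * Real.log x + K + 2 * Real.sqrt (a * x)) * N =
        α * Real.log x + (α * (Real.log N + Real.log a / 2) - Real.log (Real.Gamma (α + 1))) +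
          2 * N * Real.sqrt (a * x) := by
      rw [hb, hK]
      field_simp
    rw [hcancel]
    linarith
  have hsqrt : 2 * Real.sqrt (a * x) ≤ x / 4 + 4 * a := by
    have hsq : Real.sqrt (a * x) ^ 2 = a * x := Real.sq_sqrt (by positivity)
    refine (abs_le_of_sq_le_sq' ?_ (by positivity)).2
    nlinarith [sq_nonneg (x / 4 - 4 * a)]
  have hblog : b * Real.log x ≤ x / 4 + b * Real.log (4 * b + 1) := by
    have hc : 0 < 4 * b + 1 := by positivity
    have h := mul_le_mul_of_nonneg_left (Real.log_le_div_add_log hx hc) hb0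
    have hfrac : b * (x / (4 * b + 1)) ≤ x / 4 := by
      rw [← mul_div_assoc, div_le_div_iff₀ hc (by norm_num)]
      nlinarith
    linarith
  have hquad : Real.log (1 + x ^ 2) ≤ x / 4 + 2 * Real.log 8 := by
    have h1 : Real.log (1 + x ^ 2) ≤ Real.log ((1 + x) ^ 2) :=
      Real.log_le_log (by positivity) (by nlinarith)
    rw [Real.log_pow] at h1
    push_cast at h1
    linarith [Real.log_le_div_add_log (show 0 < 1 + x by positivity) (show (0 : ℝ) < 8 by norm_num)]
  linarith
end

section
/- Let α ≥ 0, a > 0 and N ≥ 1 be an integer. Assume (j_k)_{k≥0} is the increasing enumeration of the positive zeros of J_α, i.e. 0 < j_0 < j_1 < ⋯, J_α(j_k) = 0 for every k, and every x > 0 with J_α(x) = 0 equals j_k for some k. Define the weights w_{β,N}(x) = x^{β/2} · I_β(2N√(ax)) · e^{−Nx} for β ≥ 0 and x > 0, and the points a_{k,N} = −( j_k/(2√a·N) )². Then for every x > 0, w_{α+1,N}(x) / w_{α,N}(x) = (x/√a) · (1/N) · ∑_{k=0}^∞ 1/(x − a_{k,N}). -/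
/-- The Bessel function of the first kind
`J_α(x) = ∑_{k=0}^∞ (−1)^k (x/2)^(2k+α) / (k! Γ(k+α+1))`. -/
noncomputable def besselJ (α x : ℝ) : ℝ :=
  ∑' k : ℕ,
    (-1 : ℝ) ^ k * (x / 2) ^ (2 * (k : ℝ) + α) / (Nat.factorial k * Real.Gamma ((k : ℝ) + α + 1))

open Complex Metric Filter Topology

theorem exists_eq_prod_one_sub_div_mul {f : ℂ → ℂ} (hf : Differentiable ℂ f) (S : Finset ℂ)
    (h0 : (0 : ℂ) ∉ S) (hS : ∀ s ∈ S, f s = 0) :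
    ∃ g : ℂ → ℂ, Differentiable ℂ g ∧ ∀ z, f z = (∏ s ∈ S, (1 - z / s)) * g z := by
  induction S using Finset.induction_on with
  | empty => exact ⟨f, hf, by simp⟩
  | insert s S hs ih =>
    obtain ⟨hs0, h0S⟩ : s ≠ 0 ∧ (0 : ℂ) ∉ S := by
      simpa [eq_comm] using h0
    obtain ⟨g, hg, hfg⟩ := ih h0S fun t ht => hS t (Finset.mem_insert_of_mem ht)
    have hgs : g s = 0 := by
      have h := hS s (Finset.mem_insert_self s S)
      rw [hfg, mul_eq_zero, Finset.prod_eq_zero_iff] at h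
      refine h.resolve_left ?_
      rintro ⟨t, ht, hst⟩
      have ht0 : t ≠ 0 := fun h => h0S (h ▸ ht)
      rw [sub_eq_zero, eq_div_iff ht0, one_mul] at hst
      exact hs (hst ▸ ht)
    refine ⟨fun z => -s * dslope g s z, ?_, fun z => ?_⟩
    · have : Differentiable ℂ (dslope g s) := by
        rw [← differentiableOn_univ] at hg ⊢
        exact (differentiableOn_dslope univ_mem).2 hg
      exact this.const_mul _
    · have h := sub_smul_dslope g s z
      rw [hgs, sub_zero, smul_eq_mul] at h
      rw [hfg, Finset.prod_insert hs, ← h]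
      field_simp
      ring

theorem norm_logDeriv_le_of_norm_le_exp {g : ℂ → ℂ} {R M : ℝ} (hR : 0 < R) (hM : 0 < M)
    (hg : Differentiable ℂ g) (hg0 : g 0 = 1) (hne : ∀ z ∈ ball (0 : ℂ) R, g z ≠ 0)
    (hle : ∀ z ∈ ball (0 : ℂ) R, ‖g z‖ ≤ Real.exp M) {x : ℂ} (hx : ‖x‖ ≤ R / 4) :
    ‖logDeriv g x‖ ≤ 8 * M / R := by
  have hlog : DifferentiableOn ℂ (logDeriv g) (ball 0 R) := by
    intro z hz
    exact ((hg.analyticAt z).deriv.differentiableAt.div (hg z) (hne z hz)).differentiableWithinAt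
  obtain ⟨h, h0, hh⟩ := hlog.isExactOn_ball.with_val_at 0 0
  have hexp : ∀ z ∈ ball (0 : ℂ) R, g z = Complex.exp (h z) := by
    intro z hz
    have hd : ∀ w ∈ ball (0 : ℂ) R, HasDerivAt (fun w => g w * Complex.exp (-h w)) 0 w := by
      intro w hw
      refine ((hg w).hasDerivAt.mul (hh w hw).neg.cexp).congr_deriv ?_
      have := hne w hw
      simp only [logDeriv_apply]
      field_simp
      ring
    have hc := isOpen_ball.is_const_of_deriv_eq_zero (convex_ball (0 : ℂ) R).isPreconnected
      (fun w hw => (hd w hw).differentiableAt.differentiableWithinAt)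
      (fun w hw => (hd w hw).deriv) hz (mem_ball_self hR)
    simp only [h0, hg0, neg_zero, Complex.exp_zero, mul_one, Complex.exp_neg] at hc
    rwa [mul_inv_eq_one₀ (Complex.exp_ne_zero _)] at hc
  have hre : Set.MapsTo h (ball 0 R) {z | z.re ≤ M} := by
    intro z hz
    have := hle z hz
    rwa [hexp z hz, Complex.norm_exp, Real.exp_le_exp] at this
  have hbound : ∀ z ∈ sphere x (R / 4), ‖h z‖ ≤ 2 * M := by
    intro z hz
    have hz' : ‖z‖ ≤ R / 2 := by
      have h1 : ‖z - x‖ = R / 4 := by simpa [dist_eq_norm] using hz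
      have h2 := norm_add_le (z - x) x
      rw [sub_add_cancel] at h2
      linarith
    have hzb : z ∈ ball (0 : ℂ) R := by
      rw [mem_ball_zero_iff]; linarith
    have hhd : DifferentiableOn ℂ h (ball 0 R) := fun w hw =>
      (hh w hw).differentiableAt.differentiableWithinAt
    refine (borelCaratheodory_zero hM hhd hre hR hzb h0).trans ?_
    rw [div_le_iff₀ (by linarith)]
    nlinarith
  have hxb : closedBall x (R / 4) ⊆ ball 0 R := by
    intro z hz
    have h1 : ‖z - x‖ ≤ R / 4 := by simpa [dist_eq_norm] using hz
    have h2 := norm_add_le (z - x) x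
    rw [sub_add_cancel] at h2
    rw [mem_ball_zero_iff]
    linarith
  have hdc : DiffContOnCl ℂ h (ball x (R / 4)) := by
    apply DifferentiableOn.diffContOnCl
    intro w hw
    exact (hh w (hxb (closure_ball_subset_closedBall hw))).differentiableAt.differentiableWithinAt
  have := Complex.norm_deriv_le_of_forall_mem_sphere_norm_le (by positivity) hdc hbound
  rw [(hh x (hxb (mem_closedBall_self (by positivity)))).deriv] at this
  refine this.trans_eq ?_
  field_simp
  ring

/-- A finite-radius form of Hadamard's factorization theorem for simple zeros: in the disk of radius
`R / 4` the logarithmic derivative differs little from its partial fraction expansion. -/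
theorem norm_logDeriv_sub_sum_le {f : ℂ → ℂ} {R M : ℝ} (hR : 0 < R) (hM : 0 < M)
    (hf : Differentiable ℂ f) (hf0 : f 0 = 1) (S : Finset ℂ) (hS : ∀ s ∈ S, f s = 0)
    (hSR : ∀ s ∈ S, ‖s‖ ≤ R) (hsimple : ∀ s ∈ S, deriv f s ≠ 0)
    (hall : ∀ z ∈ ball (0 : ℂ) R, f z = 0 → z ∈ S)
    (hle : ∀ z ∈ sphere (0 : ℂ) (2 * R), ‖f z‖ ≤ Real.exp M) {x : ℂ} (hx : ‖x‖ ≤ R / 4)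
    (hfx : f x ≠ 0) :
    ‖logDeriv f x - ∑ s ∈ S, 1 / (x - s)‖ ≤ 8 * M / R := by
  have h0 : (0 : ℂ) ∉ S := fun h => by simpa [hf0] using hS 0 h
  obtain ⟨g, hg, hfg⟩ := exists_eq_prod_one_sub_div_mul hf S h0 hS
  have hg0 : g 0 = 1 := by simpa [hf0] using (hfg 0).symm
  have hPd (T : Finset ℂ) : Differentiable ℂ fun z => ∏ s ∈ T, (1 - z / s) := by fun_prop
  have hne : ∀ z ∈ ball (0 : ℂ) R, g z ≠ 0 := by
    intro z hz hgz
    have hzS : z ∈ S := hall z hz (by rw [hfg, hgz, mul_zero])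
    refine hsimple z hzS ?_
    have hP : ∏ s ∈ S, (1 - z / s) = 0 :=
      Finset.prod_eq_zero hzS (by rw [div_self (fun h => h0 (h ▸ hzS)), sub_self])
    have := ((hPd S) z).hasDerivAt.mul (hg z).hasDerivAt
    rw [hgz, hP, mul_zero, zero_mul, add_zero] at this
    rw [show f = (fun z => ∏ s ∈ S, (1 - z / s)) * g from funext hfg]
    exact this.deriv
  have hsphere : ∀ z ∈ sphere (0 : ℂ) (2 * R), ‖g z‖ ≤ Real.exp M := by
    intro z hz
    refine le_trans ?_ (hle z hz)
    rw [hfg, norm_mul, norm_prod]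
    refine le_mul_of_one_le_left (norm_nonneg _) ?_
    refine Finset.one_le_prod fun s hs => ?_
    have hs0 : 0 < ‖s‖ := norm_pos_iff.2 fun h => h0 (h ▸ hs)
    have h1 : 2 ≤ ‖z / s‖ := by
      rw [norm_div, mem_sphere_zero_iff_norm.1 hz, le_div_iff₀ hs0]
      linarith [hSR s hs]
    have h2 := norm_sub_norm_le (z / s) 1
    rw [norm_one, norm_sub_rev] at h2
    linarith
  have hball : ∀ z ∈ ball (0 : ℂ) R, ‖g z‖ ≤ Real.exp M := by
    intro z hz
    refine Complex.norm_le_of_forall_mem_frontier_norm_le (isBounded_ball (x := (0 : ℂ)) (r := 2 * R))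
      hg.diffContOnCl (fun w hw => hsphere w ?_) (subset_closure ?_)
    · rwa [frontier_ball _ (by positivity)] at hw
    · rw [mem_ball_zero_iff] at hz ⊢
      linarith
  have hlog := norm_logDeriv_le_of_norm_le_exp hR hM hg hg0 hne hball hx
  have hPx : ∀ s ∈ S, 1 - x / s ≠ 0 := by
    intro s hs h
    apply hfx
    rw [hfg, Finset.prod_eq_zero hs h, zero_mul]
  convert hlog using 2
  rw [sub_eq_iff_eq_add, show f = fun z => (∏ s ∈ S, (1 - z / s)) * g z from funext hfg,
    logDeriv_mul x (Finset.prod_ne_zero_iff.2 hPx)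
      (by intro h; apply hfx; rw [hfg, h, mul_zero]) (hPd S x) (hg x), add_comm]
  congr 1
  rw [logDeriv_prod (hf := hPx) (hd := fun s _ => by fun_prop)]
  refine Finset.sum_congr rfl fun s hs => ?_
  have hs0 : s ≠ 0 := fun h => h0 (h ▸ hs)
  have h1 : HasDerivAt (fun z : ℂ => 1 - z / s) (-(1 / s)) x := by
    simpa using ((hasDerivAt_id x).div_const s).const_sub 1
  have h2 : x - s ≠ 0 := by
    intro h
    apply hPx s hs
    rw [sub_eq_zero.1 h, div_self hs0, sub_self]
  have h3 := hPx s hs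
  rw [logDeriv_apply, h1.deriv]
  field_simp
  rw [← neg_sub s x]
  have : s - x ≠ 0 := by rwa [← neg_sub, neg_ne_zero]
  field_simp

/-- Partial fractions for the logarithmic derivative of an entire function of order at most `1 / 2`
with simple zeros. -/
theorem tendsto_sum_one_div_sub_logDeriv {f : ℂ → ℂ} {C : ℝ} (hC : 0 < C)
    (hf : Differentiable ℂ f) (hf0 : f 0 = 1) {s : ℕ → ℂ} (hs : StrictMono fun n => ‖s n‖)
    (hs' : Tendsto (fun n => ‖s n‖) atTop atTop) (hzero : ∀ z, f z = 0 ↔ ∃ n, z = s n)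
    (hsimple : ∀ n, deriv f (s n) ≠ 0) (hle : ∀ z, ‖f z‖ ≤ Real.exp (C * √‖z‖)) {x : ℂ}
    (hfx : f x ≠ 0) :
    Tendsto (fun n => ∑ k ∈ Finset.range n, 1 / (x - s k)) atTop (𝓝 (logDeriv f x)) := by
  have hinj : Function.Injective s := fun m n h => hs.injective (congrArg norm h)
  have hlim : Tendsto (fun n => 8 * (C * √(2 * ‖s n‖)) / ‖s n‖) atTop (𝓝 0) := by
    have h1 : Tendsto (fun r : ℝ => 8 * C * √2 * (√r)⁻¹) atTop (𝓝 0) := by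
      simpa using (tendsto_inv_atTop_zero.comp Real.tendsto_sqrt_atTop).const_mul (8 * C * √2)
    refine (h1.comp hs').congr fun n => ?_
    rw [Function.comp_apply, Real.sqrt_mul zero_le_two, ← one_div, ← Real.sqrt_div_self']
    ring
  rw [tendsto_iff_norm_sub_tendsto_zero]
  refine squeeze_zero' (Eventually.of_forall fun _ => norm_nonneg _) ?_ hlim
  filter_upwards [hs'.eventually_gt_atTop 0, hs'.eventually_ge_atTop (4 * ‖x‖)] with n hn hn'
  rw [norm_sub_rev, ← Finset.sum_image (f := fun t => 1 / (x - t)) (hinj.injOn)]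
  refine norm_logDeriv_sub_sum_le hn (by positivity) hf hf0 _ ?_ ?_ ?_ ?_ ?_ (by linarith) hfx
  · simp only [Finset.forall_mem_image]
    exact fun k _ => (hzero _).2 ⟨k, rfl⟩
  · simp only [Finset.forall_mem_image]
    exact fun k hk => hs.monotone (Finset.mem_range.1 hk).le
  · simp only [Finset.forall_mem_image]
    exact fun k _ => hsimple k
  · intro z hz hfz
    obtain ⟨k, rfl⟩ := (hzero z).1 hfz
    exact Finset.mem_image_of_mem _ (Finset.mem_range.2 (hs.lt_iff_lt.1 (mem_ball_zero_iff.1 hz)))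
  · intro z hz
    simpa [mem_sphere_zero_iff_norm.1 hz] using hle z

/-- The coefficients of the Bessel–Clifford function. -/
noncomputable def besselCliffordCoeff (α : ℝ) (k : ℕ) : ℝ :=
  1 / (k.factorial * Real.Gamma (k + α + 1))

/-- The Bessel–Clifford function `∑ z ^ k / (k! Γ(k + α + 1))`. -/
noncomputable def besselClifford (α : ℝ) (z : ℂ) : ℂ :=
  ∑' k : ℕ, (besselCliffordCoeff α k : ℂ) * z ^ k

section BesselClifford

variable {α : ℝ}

theorem besselCliffordCoeff_pos (hα : 0 ≤ α) (k : ℕ) : 0 < besselCliffordCoeff α k := by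
  have := Real.Gamma_pos_of_pos (show 0 < (k : ℝ) + α + 1 by positivity)
  rw [besselCliffordCoeff]
  positivity

theorem factorial_mul_Gamma_le (hα : 0 ≤ α) (k : ℕ) :
    k.factorial * Real.Gamma (α + 1) ≤ Real.Gamma (k + α + 1) := by
  induction k with
  | zero => simp
  | succ k ih =>
    have hk : 0 < (k : ℝ) + α + 1 := by positivity
    have hΓ := Real.Gamma_pos_of_pos hk
    rw [show ((k + 1 : ℕ) : ℝ) + α + 1 = (k + α + 1) + 1 by push_cast; ring,
      Real.Gamma_add_one hk.ne', Nat.factorial_succ]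
    push_cast
    rw [mul_assoc]
    exact mul_le_mul (by linarith) ih (by positivity) hk.le

theorem besselCliffordCoeff_le (hα : 0 ≤ α) (k : ℕ) :
    besselCliffordCoeff α k ≤ 1 / (k.factorial * (k.factorial * Real.Gamma (α + 1))) := by
  have := Real.Gamma_pos_of_pos (show 0 < α + 1 by positivity)
  rw [besselCliffordCoeff]
  gcongr
  exact factorial_mul_Gamma_le hα k

theorem norm_besselClifford_term_le (hα : 0 ≤ α) (z : ℂ) (k : ℕ) :
    ‖(besselCliffordCoeff α k : ℂ) * z ^ k‖ ≤
      Real.exp (√‖z‖) / Real.Gamma (α + 1) * (√‖z‖ ^ k / k.factorial) := by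
  have hΓ := Real.Gamma_pos_of_pos (show 0 < α + 1 by positivity)
  rw [norm_mul, norm_pow, Complex.norm_real, Real.norm_of_nonneg (besselCliffordCoeff_pos hα k).le]
  have h1 := Real.pow_div_factorial_le_exp (√‖z‖) (Real.sqrt_nonneg _) k
  calc besselCliffordCoeff α k * ‖z‖ ^ k
      ≤ 1 / (k.factorial * (k.factorial * Real.Gamma (α + 1))) * ‖z‖ ^ k := by
        gcongr
        exact besselCliffordCoeff_le hα k
    _ = √‖z‖ ^ k / k.factorial / Real.Gamma (α + 1) * (√‖z‖ ^ k / k.factorial) := by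
        nth_rewrite 1 [← Real.mul_self_sqrt (norm_nonneg z)]
        rw [mul_pow]
        field_simp
    _ ≤ _ := by gcongr

theorem summable_besselClifford_bound (α : ℝ) (r : ℝ) :
    Summable fun k : ℕ => Real.exp r / Real.Gamma (α + 1) * (r ^ k / k.factorial) :=
  (Real.summable_pow_div_factorial r).mul_left _

theorem hasSum_besselClifford (hα : 0 ≤ α) (z : ℂ) :
    HasSum (fun k : ℕ => (besselCliffordCoeff α k : ℂ) * z ^ k) (besselClifford α z) :=
  (Summable.of_norm_bounded (summable_besselClifford_bound α _)
    (norm_besselClifford_term_le hα z)).hasSum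

theorem norm_besselClifford_le (hα : 0 ≤ α) (z : ℂ) :
    ‖besselClifford α z‖ ≤ Real.exp (2 * √‖z‖) / Real.Gamma (α + 1) := by
  have h := tsum_of_norm_bounded (summable_besselClifford_bound α _).hasSum
    (norm_besselClifford_term_le hα z)
  refine h.trans_eq ?_
  rw [tsum_mul_left, two_mul, Real.exp_add, Real.exp_eq_exp_ℝ, NormedSpace.exp_eq_tsum_div]
  ring

theorem besselClifford_zero (α : ℝ) : besselClifford α 0 = 1 / (Real.Gamma (α + 1) : ℂ) := by
  rw [besselClifford, tsum_eq_single 0 fun k hk => by simp [hk]]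
  simp [besselCliffordCoeff]

theorem besselClifford_zero_ne_zero (hα : 0 ≤ α) : besselClifford α 0 ≠ 0 := by
  rw [besselClifford_zero]
  have := (Real.Gamma_pos_of_pos (show 0 < α + 1 by positivity)).ne'
  exact one_div_ne_zero (by exact_mod_cast this)

theorem besselCliffordCoeff_succ_mul (α : ℝ) (k : ℕ) :
    besselCliffordCoeff α (k + 1) * (k + 1) = besselCliffordCoeff (α + 1) k := by
  rw [besselCliffordCoeff, besselCliffordCoeff, Nat.factorial_succ,
    show ((k + 1 : ℕ) : ℝ) + α + 1 = k + (α + 1) + 1 by push_cast; ring]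
  have : (k : ℝ) + 1 ≠ 0 := by positivity
  push_cast
  field_simp

theorem mul_besselCliffordCoeff_add_one (hα : 0 ≤ α) (k : ℕ) :
    (k + α + 1) * besselCliffordCoeff (α + 1) k = besselCliffordCoeff α k := by
  have hk : (k : ℝ) + α + 1 ≠ 0 := by positivity
  have hΓ := (Real.Gamma_pos_of_pos (show 0 < (k : ℝ) + α + 1 by positivity)).ne'
  rw [besselCliffordCoeff, besselCliffordCoeff, ← add_assoc, Real.Gamma_add_one hk]
  field_simp

theorem hasDerivAt_besselClifford (hα : 0 ≤ α) (z : ℂ) :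
    HasDerivAt (besselClifford α) (besselClifford (α + 1) z) z := by
  have hz : z ∈ ball (0 : ℂ) (‖z‖ + 1) := by simp
  have hbound : ∀ (k : ℕ) (w : ℂ), w ∈ ball (0 : ℂ) (‖z‖ + 1) →
      ‖(besselCliffordCoeff α k : ℂ) * w ^ k‖ ≤
      Real.exp (√(‖z‖ + 1)) / Real.Gamma (α + 1) * (√(‖z‖ + 1) ^ k / k.factorial) := by
    intro k w hw
    have hΓ := Real.Gamma_pos_of_pos (show 0 < α + 1 by positivity)
    have hw' := (mem_ball_zero_iff.1 hw).le
    refine (norm_besselClifford_term_le hα w k).trans ?_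
    gcongr
  have hu := summable_besselClifford_bound α (√(‖z‖ + 1))
  have hd := differentiableOn_tsum_of_summable_norm (F := fun k w => (besselCliffordCoeff α k : ℂ) * w ^ k)
    hu (fun k => by fun_prop) isOpen_ball hbound
  have hs := hasSum_deriv_of_summable_norm (F := fun k w => (besselCliffordCoeff α k : ℂ) * w ^ k)
    hu (fun k => by fun_prop) isOpen_ball hbound hz
  have hda := (hd.differentiableAt (isOpen_ball.mem_nhds hz)).hasDerivAt
  refine hda.congr_deriv (HasSum.unique ?_ (hasSum_besselClifford (by positivity) z))
  rw [← hasSum_nat_add_iff' 1, Finset.sum_range_one] at hs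
  simp only [pow_zero, mul_one, deriv_const, sub_zero] at hs
  refine hs.congr_fun fun k => ?_
  simp only [deriv_const_mul_field', deriv_pow_field, add_tsub_cancel_right]
  rw [← besselCliffordCoeff_succ_mul α k]
  push_cast
  ring

theorem differentiable_besselClifford (hα : 0 ≤ α) : Differentiable ℂ (besselClifford α) :=
  fun z => (hasDerivAt_besselClifford hα z).differentiableAt

theorem deriv_besselClifford (hα : 0 ≤ α) : deriv (besselClifford α) = besselClifford (α + 1) :=
  funext fun z => (hasDerivAt_besselClifford hα z).deriv

theorem besselClifford_recurrence (hα : 0 ≤ α) (z : ℂ) :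
    besselClifford α z =
      (α + 1) * besselClifford (α + 1) z + z * besselClifford (α + 1 + 1) z := by
  have h1 := (hasSum_besselClifford (show 0 ≤ α + 1 by positivity) z).mul_left ((α : ℂ) + 1)
  have h2 := (hasSum_besselClifford (show 0 ≤ α + 1 + 1 by positivity) z).mul_left z
  have h3 : HasSum (fun k : ℕ => (k : ℂ) * besselCliffordCoeff (α + 1) k * z ^ k)
      (z * besselClifford (α + 1 + 1) z) := by
    rw [← hasSum_nat_add_iff' 1, Finset.sum_range_one, Nat.cast_zero, zero_mul, zero_mul, sub_zero]
    refine h2.congr_fun fun k => ?_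
    rw [← besselCliffordCoeff_succ_mul (α + 1) k]
    push_cast
    ring
  refine (hasSum_besselClifford hα z).unique ?_
  refine (h1.add h3).congr_fun fun k => ?_
  rw [← mul_besselCliffordCoeff_add_one hα k]
  push_cast
  ring

theorem besselClifford_ofReal (α x : ℝ) :
    besselClifford α x = ((∑' k : ℕ, besselCliffordCoeff α k * x ^ k : ℝ) : ℂ) := by
  rw [besselClifford, Complex.ofReal_tsum]
  push_cast
  rfl

theorem besselClifford_ofReal_ne_zero (hα : 0 ≤ α) {x : ℝ} (hx : 0 ≤ x) :
    besselClifford α x ≠ 0 := by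
  rw [besselClifford_ofReal, Complex.ofReal_ne_zero]
  have hs := hasSum_besselClifford hα x
  have hs' : Summable fun k : ℕ => besselCliffordCoeff α k * x ^ k := by
    have := hs.summable
    exact_mod_cast this
  have hnn (k : ℕ) : 0 ≤ besselCliffordCoeff α k * x ^ k :=
    mul_nonneg (besselCliffordCoeff_pos hα k).le (pow_nonneg hx k)
  refine (hs'.tsum_pos hnn 0 ?_).ne'
  simpa using besselCliffordCoeff_pos hα 0

theorem iteratedDeriv_besselClifford (hα : 0 ≤ α) (n : ℕ) :
    iteratedDeriv n (besselClifford α) = besselClifford (α + n) := by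
  induction n with
  | zero => simp
  | succ n ih =>
    rw [iteratedDeriv_succ, ih, deriv_besselClifford (by positivity)]
    push_cast
    rw [add_assoc]

theorem deriv_besselClifford_ne_zero (hα : 0 ≤ α) {z : ℂ} (hz : besselClifford α z = 0) :
    deriv (besselClifford α) z ≠ 0 := by
  intro hz'
  have hz0 : z ≠ 0 := by
    rintro rfl
    exact besselClifford_zero_ne_zero hα hz
  rw [deriv_besselClifford hα] at hz'
  have hall : ∀ n : ℕ, besselClifford (α + n) z = 0 ∧ besselClifford (α + n + 1) z = 0 := by
    intro n
    induction n with
    | zero => simpa using ⟨hz, hz'⟩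
    | succ n ih =>
      have h := besselClifford_recurrence (show 0 ≤ α + n by positivity) z
      rw [ih.1, ih.2, mul_zero, zero_add, eq_comm, mul_eq_zero] at h
      push_cast
      rw [← add_assoc]
      exact ⟨ih.2, h.resolve_left hz0⟩
  have h := Complex.taylorSeries_eq_of_entire' z 0 (differentiable_besselClifford hα)
  simp only [iteratedDeriv_besselClifford hα, (hall _).1, mul_zero, zero_mul, tsum_zero] at h
  exact besselClifford_zero_ne_zero hα h.symm

theorem im_eq_zero_of_besselClifford_eq_zero (hα : 0 ≤ α) {z : ℂ} (hz : besselClifford α z = 0) :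
    z.im = 0 := by
  by_contra him
  set u : ℝ → ℂ := fun t => besselClifford α (z * t) with hu
  set v : ℝ → ℂ := fun t => besselClifford (α + 1) (z * t) with hv
  have hud (t : ℝ) : HasDerivAt u (z * v t) t := by
    have h1 : HasDerivAt (fun t : ℝ => z * (t : ℂ)) z t := by
      simpa using (Complex.ofRealCLM.hasDerivAt (x := t)).const_mul z
    exact ((hasDerivAt_besselClifford hα (z * t)).comp t h1).congr_deriv (mul_comm _ _)
  have hvd (t : ℝ) : HasDerivAt v (z * besselClifford (α + 1 + 1) (z * t)) t := by
    have h1 : HasDerivAt (fun t : ℝ => z * (t : ℂ)) z t := by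
      simpa using (Complex.ofRealCLM.hasDerivAt (x := t)).const_mul z
    exact ((hasDerivAt_besselClifford (show 0 ≤ α + 1 by positivity) (z * t)).comp t
      h1).congr_deriv (mul_comm _ _)
  have huc : Continuous u := continuous_iff_continuousAt.2 fun t => (hud t).continuousAt
  have hvc : Continuous v := continuous_iff_continuousAt.2 fun t => (hvd t).continuousAt
  -- The flux of Bessel equation in self-adjoint form; its imaginary part is monotone.
  set E : ℝ → ℂ := fun t => ((t ^ (α + 1) : ℝ) : ℂ) * (z * v t) * starRingEnd ℂ (u t) with hE
  have hEd (t : ℝ) (ht : 0 < t) : HasDerivAt E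
      (z * ((t ^ α * ‖u t‖ ^ 2 : ℝ) : ℂ) + ((t ^ (α + 1) * ‖z * v t‖ ^ 2 : ℝ) : ℂ)) t := by
    have h1 : HasDerivAt (fun t : ℝ => ((t ^ (α + 1) : ℝ) : ℂ)) (((α + 1) * t ^ α : ℝ) : ℂ) t := by
      have := Real.hasDerivAt_rpow_const (p := α + 1) (Or.inl ht.ne')
      rw [add_sub_cancel_right] at this
      exact this.ofReal_comp
    have h2 : HasDerivAt (fun t => starRingEnd ℂ (u t)) (starRingEnd ℂ (z * v t)) t :=
      (hud t).star
    refine ((h1.mul ((hvd t).const_mul z)).mul h2).congr_deriv ?_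
    have hr : u t = (α + 1) * v t + z * t * besselClifford (α + 1 + 1) (z * t) :=
      besselClifford_recurrence hα (z * t)
    have ht' : t ^ (α + 1) = t ^ α * t := by rw [Real.rpow_add ht, Real.rpow_one]
    have hn (w : ℂ) : ((‖w‖ : ℝ) : ℂ) ^ 2 = w * starRingEnd ℂ w := (Complex.mul_conj' w).symm
    push_cast
    rw [hn, hn, Pi.mul_apply, ht']
    push_cast
    nth_rewrite 2 [hr]
    ring
  have hEc : Continuous E := by
    have h1 : Continuous fun t : ℝ => t ^ (α + 1) := Real.continuous_rpow_const (by positivity)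
    exact ((continuous_ofReal.comp h1).mul (continuous_const.mul hvc)).mul
      (continuous_conj.comp huc)
  set G : ℝ → ℝ := fun t => (E t).im / z.im with hG
  have hGd (t : ℝ) (ht : 0 < t) : HasDerivAt G (t ^ α * ‖u t‖ ^ 2) t := by
    refine ((Complex.imCLM.hasFDerivAt.comp_hasDerivAt t (hEd t ht)).div_const z.im).congr_deriv ?_
    rw [Complex.imCLM_apply, Complex.add_im, Complex.im_mul_ofReal, Complex.ofReal_im, add_zero,
      mul_div_cancel_left₀ _ him]
  have hGc : Continuous G := (continuous_im.comp hEc).div_const _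
  have hG0 : G 0 = 0 := by
    simp [hG, hE, Real.zero_rpow (show α + 1 ≠ 0 by positivity)]
  have hG1 : G 1 = 0 := by
    simp [hG, hE, hu, hz]
  have hmono : MonotoneOn G (Set.Icc 0 1) := by
    refine monotoneOn_of_deriv_nonneg (convex_Icc 0 1) hGc.continuousOn ?_ ?_ <;>
      rw [interior_Icc] <;> intro t ht
    · exact (hGd t ht.1).differentiableAt.differentiableWithinAt
    · rw [(hGd t ht.1).deriv]
      have := Real.rpow_nonneg ht.1.le α
      positivity
  have hGz : ∀ t ∈ Set.Icc (0 : ℝ) 1, G t = 0 := by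
    intro t ht
    refine le_antisymm ?_ ?_
    · rw [← hG1]
      exact hmono ht (by simp) ht.2
    · rw [← hG0]
      exact hmono (by simp) ht ht.1
  have huz : ∀ t ∈ Set.Ioo (0 : ℝ) 1, u t = 0 := by
    intro t ht
    have h1 : G =ᶠ[𝓝 t] fun _ => 0 := by
      filter_upwards [Ioo_mem_nhds ht.1 ht.2] with r hr
      exact hGz r ⟨hr.1.le, hr.2.le⟩
    have h2 := (hGd t ht.1).unique ((hasDerivAt_const t (0 : ℝ)).congr_of_eventuallyEq h1)
    have h3 := (Real.rpow_pos_of_pos ht.1 α).ne'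
    simpa [h3] using h2
  have hu0 : u 0 = 0 := by
    have hcl : (0 : ℝ) ∈ closure (Set.Ioo (0 : ℝ) 1) := by
      rw [closure_Ioo zero_ne_one]
      simp
    exact (isClosed_eq huc continuous_const).closure_subset_iff.2 huz hcl
  exact besselClifford_zero_ne_zero hα (by simpa [hu] using hu0)

theorem exists_eq_neg_sq_of_besselClifford_eq_zero (hα : 0 ≤ α) {z : ℂ}
    (hz : besselClifford α z = 0) : ∃ x : ℝ, 0 < x ∧ z = ((-(x / 2) ^ 2 : ℝ) : ℂ) := by
  have hre : z = (z.re : ℂ) :=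
    Complex.ext rfl (by simpa using im_eq_zero_of_besselClifford_eq_zero hα hz)
  have hneg : z.re < 0 := by
    by_contra! h
    exact besselClifford_ofReal_ne_zero hα h (hre ▸ hz)
  refine ⟨2 * √(-z.re), by have := Real.sqrt_pos.2 (neg_pos.2 hneg); positivity, ?_⟩
  rw [mul_div_cancel_left₀ _ two_ne_zero, Real.sq_sqrt (by linarith), neg_neg]
  exact hre

end BesselClifford

theorem hasSum_one_div_besselClifford {α : ℝ} (hα : 0 ≤ α) {j : ℕ → ℝ} (hmono : StrictMono j)
    (hpos : ∀ k, 0 < j k) (hzero : ∀ k, besselClifford α ((-(j k / 2) ^ 2 : ℝ) : ℂ) = 0)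
    (hall : ∀ x : ℝ, 0 < x → besselClifford α ((-(x / 2) ^ 2 : ℝ) : ℂ) = 0 → ∃ k, x = j k)
    {y : ℝ} (hy : 0 ≤ y) :
    HasSum (fun k => 1 / (y + (j k / 2) ^ 2))
      ((∑' k : ℕ, besselCliffordCoeff (α + 1) k * y ^ k) /
        ∑' k : ℕ, besselCliffordCoeff α k * y ^ k) := by
  have hΓ := Real.Gamma_pos_of_pos (show 0 < α + 1 by positivity)
  have hd := differentiable_besselClifford hα
  have hjtop : Tendsto j atTop atTop := by
    refine (tendsto_atTop_of_monotone hmono.monotone).resolve_right ?_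
    rintro ⟨l, hl⟩
    have hlt (n : ℕ) : j n < l :=
      (hmono n.lt_succ_self).trans_le (hmono.monotone.ge_of_tendsto hl (n + 1))
    have hw : Tendsto (fun n => ((-(j n / 2) ^ 2 : ℝ) : ℂ)) atTop
        (𝓝[≠] ((-(l / 2) ^ 2 : ℝ) : ℂ)) := by
      refine tendsto_nhdsWithin_iff.2 ⟨?_, Eventually.of_forall fun n h => ?_⟩
      · exact (continuous_ofReal.tendsto _).comp ((hl.div_const 2).pow 2).neg
      · have h1 : (-(j n / 2) ^ 2 : ℝ) = -(l / 2) ^ 2 := Complex.ofReal_injective h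
        nlinarith [hlt n, hpos n]
    have hzf := hw.frequently (p := fun z => besselClifford α z = 0) (Frequently.of_forall hzero)
    have han : AnalyticOnNhd ℂ (besselClifford α) Set.univ := fun z _ => hd.analyticAt z
    have h0 := han.eq_of_frequently_eq (g := fun _ => 0) (fun z _ => analyticAt_const) hzf
    exact besselClifford_zero_ne_zero hα (congrFun h0 0)
  have hnorm (n : ℕ) : ‖((-(j n / 2) ^ 2 : ℝ) : ℂ)‖ = (j n / 2) ^ 2 := by
    rw [Complex.norm_real, norm_neg, Real.norm_of_nonneg (by positivity)]
  have hΓ' : (Real.Gamma (α + 1) : ℂ) ≠ 0 := by exact_mod_cast hΓ.ne'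
  have hyne := besselClifford_ofReal_ne_zero hα hy
  have key := tendsto_sum_one_div_sub_logDeriv
    (f := fun z => Real.Gamma (α + 1) * besselClifford α z)
    (s := fun n => ((-(j n / 2) ^ 2 : ℝ) : ℂ)) (x := y) zero_lt_two (hd.const_mul _)
    (by rw [besselClifford_zero, mul_one_div_cancel hΓ'])
    (by
      intro m n hmn
      simp only [hnorm]
      have := hmono hmn
      have := hpos m
      gcongr)
    (by
      simp only [hnorm]
      exact (tendsto_pow_atTop two_ne_zero).comp (hjtop.atTop_div_const two_pos))
    (by
      intro z
      rw [mul_eq_zero, or_iff_right hΓ']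
      constructor
      · intro hz
        obtain ⟨x, hx, rfl⟩ := exists_eq_neg_sq_of_besselClifford_eq_zero hα hz
        obtain ⟨k, rfl⟩ := hall x hx hz
        exact ⟨k, rfl⟩
      · rintro ⟨n, rfl⟩
        exact hzero n)
    (by
      intro n
      rw [deriv_const_mul_field]
      exact mul_ne_zero hΓ' (deriv_besselClifford_ne_zero hα (hzero n)))
    (by
      intro z
      rw [norm_mul, Complex.norm_real, Real.norm_of_nonneg hΓ.le, mul_comm, ← le_div_iff₀ hΓ]
      exact norm_besselClifford_le hα z)
    (mul_ne_zero hΓ' hyne)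
  rw [hasSum_iff_tendsto_nat_of_nonneg (fun k => by positivity)]
  rw [logDeriv_const_mul _ _ hΓ', logDeriv_apply, deriv_besselClifford hα, besselClifford_ofReal,
    besselClifford_ofReal, ← Complex.ofReal_div] at key
  have hre := (continuous_re.tendsto _).comp key
  rw [Complex.ofReal_re] at hre
  refine hre.congr fun n => ?_
  have h : ∑ k ∈ Finset.range n, 1 / ((y : ℂ) - ((-(j k / 2) ^ 2 : ℝ) : ℂ)) =
      ((∑ k ∈ Finset.range n, 1 / (y + (j k / 2) ^ 2) : ℝ) : ℂ) := by
    push_cast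
    simp only [sub_neg_eq_add]
  rw [Function.comp_apply, h, Complex.ofReal_re]

theorem rpow_two_mul_natCast_add {x : ℝ} (hx : 0 < x) (α : ℝ) (k : ℕ) :
    x ^ (2 * (k : ℝ) + α) = x ^ α * (x ^ 2) ^ k := by
  rw [Real.rpow_add hx, Real.rpow_mul hx.le, Real.rpow_natCast, Real.rpow_two, mul_comm]

theorem besselI_eq_rpow_mul (α : ℝ) {x : ℝ} (hx : 0 < x) :
    besselI α x = (x / 2) ^ α * ∑' k : ℕ, besselCliffordCoeff α k * ((x / 2) ^ 2) ^ k := by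
  rw [besselI, ← tsum_mul_left]
  refine tsum_congr fun k => ?_
  rw [rpow_two_mul_natCast_add (half_pos hx), besselCliffordCoeff]
  ring

theorem besselJ_eq_rpow_mul (α : ℝ) {x : ℝ} (hx : 0 < x) :
    besselJ α x = (x / 2) ^ α * ∑' k : ℕ, besselCliffordCoeff α k * (-(x / 2) ^ 2) ^ k := by
  rw [besselJ, ← tsum_mul_left]
  refine tsum_congr fun k => ?_
  rw [rpow_two_mul_natCast_add (half_pos hx), besselCliffordCoeff, neg_pow ((x / 2) ^ 2)]
  ring

theorem besselJ_eq_zero_iff (α : ℝ) {x : ℝ} (hx : 0 < x) :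
    besselJ α x = 0 ↔ besselClifford α ((-(x / 2) ^ 2 : ℝ) : ℂ) = 0 := by
  rw [besselClifford_ofReal, Complex.ofReal_eq_zero, besselJ_eq_rpow_mul α hx, mul_eq_zero,
    or_iff_right (Real.rpow_pos_of_pos (half_pos hx) α).ne']

theorem stmt18 (α a : ℝ) (hα : 0 ≤ α) (ha : 0 < a) (N : ℕ) (hN : 1 ≤ N)
    (j : ℕ → ℝ) (hmono : StrictMono j) (hpos : ∀ k, 0 < j k)
    (hzero : ∀ k, besselJ α (j k) = 0)
    (hall : ∀ x : ℝ, 0 < x → besselJ α x = 0 → ∃ k, x = j k)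
    (x : ℝ) (hx : 0 < x) :
    (x ^ ((α + 1) / 2) * besselI (α + 1) (2 * N * Real.sqrt (a * x)) * Real.exp (-(N * x))) /
        (x ^ (α / 2) * besselI α (2 * N * Real.sqrt (a * x)) * Real.exp (-(N * x))) =
      (x / Real.sqrt a) * (1 / N) *
        ∑' k : ℕ, 1 / (x - (-((j k / (2 * Real.sqrt a * N)) ^ 2))) := by
  have hN0 : 0 < (N : ℝ) := by exact_mod_cast hN
  have hsa := Real.sqrt_pos.2 ha
  have hsx := Real.sqrt_pos.2 hx
  have hsa2 := Real.sq_sqrt ha.le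
  have hsx2 := Real.sq_sqrt hx.le
  have hax : 0 < √(a * x) := Real.sqrt_pos.2 (by positivity)
  have hy : (0 : ℝ) < N ^ 2 * (a * x) := by positivity
  have hsum := hasSum_one_div_besselClifford hα hmono hpos
    (fun k => (besselJ_eq_zero_iff α (hpos k)).1 (hzero k))
    (fun t ht h => hall t ht ((besselJ_eq_zero_iff α ht).2 h)) hy.le
  have hterm (k : ℕ) : 1 / (x - (-((j k / (2 * √a * N)) ^ 2))) =
      a * N ^ 2 * (1 / (N ^ 2 * (a * x) + (j k / 2) ^ 2)) := by
    have hj := hpos k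
    have h1 : x - (-((j k / (2 * √a * N)) ^ 2)) = (N ^ 2 * (a * x) + (j k / 2) ^ 2) / (a * N ^ 2) := by
      rw [div_pow, mul_pow, mul_pow, hsa2]
      field_simp
      ring
    rw [h1, one_div_div]
    ring
  have hD : ∑' k : ℕ, besselCliffordCoeff α k * (N ^ 2 * (a * x)) ^ k ≠ 0 := by
    have := besselClifford_ofReal_ne_zero hα hy.le
    rwa [besselClifford_ofReal, Complex.ofReal_ne_zero] at this
  have hhalf : 2 * N * √(a * x) / 2 = N * √(a * x) := by ring
  rw [tsum_congr hterm, tsum_mul_left, hsum.tsum_eq, besselI_eq_rpow_mul _ (by positivity),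
    besselI_eq_rpow_mul _ (by positivity), hhalf, mul_pow, Real.sq_sqrt (by positivity), add_div,
    Real.rpow_add hx, Real.rpow_add_one (by positivity), ← Real.sqrt_eq_rpow]
  have h1 := (Real.rpow_pos_of_pos hx (α / 2)).ne'
  have h2 := (Real.rpow_pos_of_pos (show 0 < N * √(a * x) by positivity) α).ne'
  have h3 := (Real.exp_pos (-(N * x))).ne'
  rw [Real.sqrt_mul ha.le] at h2 ⊢
  generalize ∑' k : ℕ, besselCliffordCoeff α k * (N ^ 2 * (a * x)) ^ k = D at hD ⊢
  generalize ∑' k : ℕ, besselCliffordCoeff (α + 1) k * (N ^ 2 * (a * x)) ^ k = D'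
  generalize (N * (√a * √x)) ^ α = p at h2 ⊢
  generalize x ^ (α / 2) = q at h1 ⊢
  generalize Real.exp (-(N * x)) = e at h3 ⊢
  field_simp
  rw [hsa2, hsx2]
  ring
end

section
/- Let α ≥ 0 and a > 0. Assume (j_k)_{k≥0} is the increasing enumeration of the positive zeros of J_α, i.e. 0 < j_0 < j_1 < ⋯, J_α(j_k) = 0 for every k, and every x > 0 with J_α(x) = 0 equals j_k for some k. Define a_{k,N} = −( j_k/(2√a·N) )². Then for every b < 0, (1/N)·card{ k ∈ ℕ : a_{k,N} ≥ b } → (2/π)·√(a·|b|) as N → ∞; that is, the normalized counting measures σ_N = (1/N)∑_{k≥0} δ(a_{k,N}) satisfy σ_N([b, 0]) → (√a/π)·∫_b^0 |x|^{−1/2} dx. -/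
open Filter Topology Set

section PowerSeries

variable {c : ℕ → ℝ}

theorem summable_deriv_coeff_mul_pow (hc : ∀ r : ℝ, Summable fun k => c k * r ^ k) (r : ℝ) :
    Summable fun k : ℕ => c k * (k * r ^ (k - 1)) := by
  refine Summable.of_norm_bounded (hc (2 * (1 + |r|))).norm fun k => ?_
  have hr : (1 : ℝ) ≤ 1 + |r| := by linarith [abs_nonneg r]
  have hk : (k : ℝ) ≤ 2 ^ k := by exact_mod_cast Nat.lt_two_pow_self.le
  have hpow : |r| ^ (k - 1) ≤ (1 + |r|) ^ k :=
    (pow_le_pow_left₀ (abs_nonneg r) (by linarith) _).trans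
      (pow_le_pow_right₀ hr (Nat.sub_le k 1))
  simp only [norm_mul, norm_pow, Real.norm_eq_abs, Nat.abs_cast, mul_pow, abs_two]
  rw [abs_of_nonneg (by linarith : 0 ≤ 1 + |r|)]
  gcongr

theorem summable_succ_mul_coeff_succ_mul_pow (hc : ∀ r : ℝ, Summable fun k => c k * r ^ k)
    (r : ℝ) : Summable fun k : ℕ => ((k + 1 : ℝ) * c (k + 1)) * r ^ k := by
  have h := (summable_nat_add_iff 1).2 (summable_deriv_coeff_mul_pow hc r)
  refine h.congr fun k => ?_
  push_cast
  ring

theorem hasDerivAt_tsum_coeff_mul_pow (hc : ∀ r : ℝ, Summable fun k => c k * r ^ k) (t : ℝ) :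
    HasDerivAt (fun s => ∑' k, c k * s ^ k) (∑' k : ℕ, ((k + 1 : ℝ) * c (k + 1)) * t ^ k) t := by
  have key : HasDerivAt (fun s => ∑' k, c k * s ^ k) (∑' k : ℕ, c k * (k * t ^ (k - 1))) t := by
    refine hasDerivAt_tsum_of_isPreconnected (t := Metric.ball 0 (|t| + 1)) (y₀ := 0)
      (summable_deriv_coeff_mul_pow hc (|t| + 1)).norm Metric.isOpen_ball
      (convex_ball _ _).isPreconnected (fun n y _ => (hasDerivAt_pow n y).const_mul (c n))
      (fun n y hy => ?_) (by simp; positivity) (hc 0) (by simp)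
    have hy' : |y| ≤ |t| + 1 := by
      simpa using (mem_ball_zero_iff.1 hy).le
    simp only [norm_mul, norm_pow, Real.norm_eq_abs, Nat.abs_cast]
    rw [abs_of_nonneg (by positivity : 0 ≤ |t| + 1)]
    gcongr
  refine key.congr_deriv ?_
  rw [(summable_deriv_coeff_mul_pow hc t).tsum_eq_zero_add]
  simp only [Nat.cast_zero, zero_mul, mul_zero, zero_add]
  refine tsum_congr fun k => ?_
  push_cast
  ring

end PowerSeries

section Sturm

variable {u u' q : ℝ → ℝ} {p p' m : ℝ}

/-- Sturm comparison: two zeros between which a solution of `u'' = -q u` with `q < m²` is positive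
are at distance at least `π / m`. -/
theorem sturm_gap_lower_of_pos (hpp : p < p') (hm : 0 < m)
    (hu : ∀ x ∈ Icc p p', HasDerivAt u (u' x) x)
    (hu' : ∀ x ∈ Icc p p', HasDerivAt u' (-(q x) * u x) x)
    (hq : ∀ x ∈ Ioo p p', q x < m ^ 2) (hp : u p = 0) (hp' : u p' = 0)
    (hpos : ∀ x ∈ Ioo p p', 0 < u x) : Real.pi / m ≤ p' - p := by
  by_contra! hlt
  rw [lt_div_iff₀ hm] at hlt
  set v : ℝ → ℝ := fun x => Real.cos (m * (x - (p + p') / 2)) with hv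
  set v' : ℝ → ℝ := fun x => -Real.sin (m * (x - (p + p') / 2)) * m
  have hlin : ∀ x, HasDerivAt (fun x => m * (x - (p + p') / 2)) m x := fun x => by
    simpa using ((hasDerivAt_id x).sub_const ((p + p') / 2)).const_mul m
  have hvd : ∀ x, HasDerivAt v (v' x) x := fun x => (hlin x).cos
  have hvd' : ∀ x, HasDerivAt v' (-m ^ 2 * v x) x := fun x => by
    refine HasDerivAt.congr_deriv ((hlin x).sin.neg.mul_const m) ?_
    simp only [hv]; ring
  have hvpos : ∀ x ∈ Icc p p', 0 < v x := fun x hx => by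
    apply Real.cos_pos_of_mem_Ioo
    constructor <;> nlinarith [hx.1, hx.2]
  have hWd : ∀ x ∈ Icc p p', HasDerivAt (fun x => u' x * v x - u x * v' x)
      ((m ^ 2 - q x) * u x * v x) x := fun x hx => by
    refine HasDerivAt.congr_deriv (((hu' x hx).mul (hvd x)).sub ((hu x hx).mul (hvd' x))) ?_
    ring
  have hW : StrictMonoOn (fun x => u' x * v x - u x * v' x) (Icc p p') := by
    refine strictMonoOn_of_deriv_pos (convex_Icc _ _)
      (fun x hx => (hWd x hx).continuousAt.continuousWithinAt) fun x hx => ?_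
    rw [interior_Icc] at hx
    rw [(hWd x (Ioo_subset_Icc_self hx)).deriv]
    exact mul_pos (mul_pos (sub_pos.2 (hq x hx)) (hpos x hx)) (hvpos x (Ioo_subset_Icc_self hx))
  have hd : ∀ x ∈ Icc p p', HasDerivAt (fun x => u x / v x)
      ((u' x * v x - u x * v' x) / v x ^ 2) x :=
    fun x hx => (hu x hx).div (hvd x) (hvpos x hx).ne'
  obtain ⟨ξ, hξ, hξ0⟩ := exists_hasDerivAt_eq_zero hpp
    (fun x hx => (hd x hx).continuousAt.continuousWithinAt) (by simp [hp, hp'])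
    (fun x hx => hd x (Ioo_subset_Icc_self hx))
  have hξI := Ioo_subset_Icc_self hξ
  have hWξ : u' ξ * v ξ - u ξ * v' ξ = 0 := by
    rcases div_eq_zero_iff.1 hξ0 with h | h
    · exact h
    · exact absurd h (pow_pos (hvpos ξ hξI) 2).ne'
  have hsub : Icc p ξ ⊆ Icc p p' := Icc_subset_Icc_right hξ.2.le
  have hanti : StrictAntiOn (fun x => u x / v x) (Icc p ξ) := by
    refine strictAntiOn_of_deriv_neg (convex_Icc _ _)
      (fun x hx => (hd x (hsub hx)).continuousAt.continuousWithinAt) fun x hx => ?_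
    rw [interior_Icc] at hx
    have hxI := hsub (Ioo_subset_Icc_self hx)
    rw [(hd x hxI).deriv]
    exact div_neg_of_neg_of_pos (hWξ ▸ hW hxI hξI hx.2) (pow_pos (hvpos x hxI) 2)
  have h1 := hanti (left_mem_Icc.2 hξ.1.le) (right_mem_Icc.2 hξ.1.le) hξ.1
  simp only [hp, zero_div] at h1
  exact h1.not_ge (div_pos (hpos ξ hξ) (hvpos ξ hξI)).le

/-- Sturm comparison: two points between which a solution of `u'' = -q u` with `q > m²` is positive
and the first of which is a zero are at distance at most `π / m`. -/
theorem sturm_gap_upper_of_pos (hm : 0 < m)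
    (hu : ∀ x ∈ Icc p p', HasDerivAt u (u' x) x)
    (hu' : ∀ x ∈ Icc p p', HasDerivAt u' (-(q x) * u x) x)
    (hq : ∀ x ∈ Ioo p p', m ^ 2 < q x) (hp : u p = 0)
    (hpos : ∀ x ∈ Ioo p p', 0 < u x) : p' - p ≤ Real.pi / m := by
  by_contra! hlt
  set r := p + Real.pi / m with hr
  have hpr : p < r := by have := div_pos Real.pi_pos hm; linarith
  have hrp' : r < p' := by linarith
  have hsub : Icc p r ⊆ Icc p p' := Icc_subset_Icc_right hrp'.le
  have hmr : m * (r - p) = Real.pi := by rw [hr]; field_simp; ring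
  set v : ℝ → ℝ := fun x => Real.sin (m * (x - p)) with hv
  set v' : ℝ → ℝ := fun x => Real.cos (m * (x - p)) * m
  have hlin : ∀ x, HasDerivAt (fun x => m * (x - p)) m x := fun x => by
    simpa using ((hasDerivAt_id x).sub_const p).const_mul m
  have hvd : ∀ x, HasDerivAt v (v' x) x := fun x => (hlin x).sin
  have hvd' : ∀ x, HasDerivAt v' (-m ^ 2 * v x) x := fun x => by
    refine HasDerivAt.congr_deriv ((hlin x).cos.mul_const m) ?_
    simp only [hv]; ring
  have hvpos : ∀ x ∈ Ioo p r, 0 < v x := fun x hx =>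
    Real.sin_pos_of_pos_of_lt_pi (mul_pos hm (sub_pos.2 hx.1))
      (hmr ▸ mul_lt_mul_of_pos_left (by linarith [hx.2]) hm)
  have hWd : ∀ x ∈ Icc p r, HasDerivAt (fun x => u' x * v x - u x * v' x)
      ((m ^ 2 - q x) * (u x * v x)) x := fun x hx => by
    refine HasDerivAt.congr_deriv (((hu' x (hsub hx)).mul (hvd x)).sub
      ((hu x (hsub hx)).mul (hvd' x))) ?_
    ring
  have hW : StrictAntiOn (fun x => u' x * v x - u x * v' x) (Icc p r) := by
    refine strictAntiOn_of_deriv_neg (convex_Icc _ _)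
      (fun x hx => (hWd x hx).continuousAt.continuousWithinAt) fun x hx => ?_
    rw [interior_Icc] at hx
    have hx' : x ∈ Ioo p p' := ⟨hx.1, hx.2.trans hrp'⟩
    rw [(hWd x (Ioo_subset_Icc_self hx)).deriv]
    exact mul_neg_of_neg_of_pos (sub_neg.2 (hq x hx')) (mul_pos (hpos x hx') (hvpos x hx))
  have h1 := hW (left_mem_Icc.2 hpr.le) (right_mem_Icc.2 hpr.le) hpr
  simp only [hv, v', hmr, hp, sub_self, mul_zero, Real.sin_zero, Real.sin_pi, Real.cos_pi,
    zero_mul] at h1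
  nlinarith [mul_pos (hpos r ⟨hpr, hrp'⟩) hm]

theorem forall_pos_or_forall_neg_of_ne_zero (hu : ContinuousOn u (Ioo p p'))
    (hne : ∀ x ∈ Ioo p p', u x ≠ 0) :
    (∀ x ∈ Ioo p p', 0 < u x) ∨ ∀ x ∈ Ioo p p', u x < 0 := by
  by_contra! h
  obtain ⟨⟨x, hx, hux⟩, y, hy, huy⟩ := h
  obtain ⟨z, hz, hz0⟩ := isPreconnected_Ioo.intermediate_value hx hy hu ⟨hux, huy⟩
  exact hne z hz hz0

theorem sturm_gap_lower (hpp : p < p') (hm : 0 < m)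
    (hu : ∀ x ∈ Icc p p', HasDerivAt u (u' x) x)
    (hu' : ∀ x ∈ Icc p p', HasDerivAt u' (-(q x) * u x) x)
    (hq : ∀ x ∈ Ioo p p', q x < m ^ 2) (hp : u p = 0) (hp' : u p' = 0)
    (hne : ∀ x ∈ Ioo p p', u x ≠ 0) : Real.pi / m ≤ p' - p := by
  rcases forall_pos_or_forall_neg_of_ne_zero (fun x hx =>
    (hu x (Ioo_subset_Icc_self hx)).continuousAt.continuousWithinAt) hne with h | h
  · exact sturm_gap_lower_of_pos hpp hm hu hu' hq hp hp' h
  · refine sturm_gap_lower_of_pos (u := -u) (u' := -u') hpp hm (fun x hx => (hu x hx).neg)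
      (fun x hx => ?_) hq (by simp [hp]) (by simp [hp']) (fun x hx => neg_pos.2 (h x hx))
    simpa using (hu' x hx).neg

theorem sturm_gap_upper (hm : 0 < m)
    (hu : ∀ x ∈ Icc p p', HasDerivAt u (u' x) x)
    (hu' : ∀ x ∈ Icc p p', HasDerivAt u' (-(q x) * u x) x)
    (hq : ∀ x ∈ Ioo p p', m ^ 2 < q x) (hp : u p = 0)
    (hne : ∀ x ∈ Ioo p p', u x ≠ 0) : p' - p ≤ Real.pi / m := by
  rcases forall_pos_or_forall_neg_of_ne_zero (fun x hx =>
    (hu x (Ioo_subset_Icc_self hx)).continuousAt.continuousWithinAt) hne with h | h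
  · exact sturm_gap_upper_of_pos hm hu hu' hq hp h
  · refine sturm_gap_upper_of_pos (u := -u) (u' := -u') hm (fun x hx => (hu x hx).neg)
      (fun x hx => ?_) hq (by simp [hp]) (fun x hx => neg_pos.2 (h x hx))
    simpa using (hu' x hx).neg

/-- If a solution of `u'' = -q u` on `(0, ∞)` with `q → 1` has its zeros enumerated by a strictly
increasing sequence, then the gaps between consecutive zeros tend to `π`. -/
theorem tendsto_zero_gap_of_tendsto_one {z : ℕ → ℝ} (hmono : StrictMono z) (hpos : ∀ k, 0 < z k)
    (hu : ∀ x, 0 < x → HasDerivAt u (u' x) x)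
    (hu' : ∀ x, 0 < x → HasDerivAt u' (-(q x) * u x) x)
    (hq : Tendsto q atTop (𝓝 1)) (hqb : ∀ ε > 0, BddAbove (q '' Ici ε))
    (hzero : ∀ k, u (z k) = 0) (hall : ∀ x, 0 < x → u x = 0 → ∃ k, x = z k) :
    Tendsto (fun k => z (k + 1) - z k) atTop (𝓝 Real.pi) := by
  have hlt : ∀ k, z k < z (k + 1) := fun k => hmono k.lt_succ_self
  have hne : ∀ k, ∀ x ∈ Ioo (z k) (z (k + 1)), u x ≠ 0 := fun k x hx h0 => by
    obtain ⟨i, rfl⟩ := hall x ((hpos k).trans hx.1) h0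
    have h1 := hmono.lt_iff_lt.1 hx.1
    have h2 := hmono.lt_iff_lt.1 hx.2
    omega
  have hI : ∀ k, ∀ x ∈ Icc (z k) (z (k + 1)), 0 < x := fun k x hx => (hpos k).trans_le hx.1
  have lower : ∀ m > 0, ∀ k, (∀ x, z k < x → q x < m ^ 2) → Real.pi / m ≤ z (k + 1) - z k :=
    fun m hm k hqk => sturm_gap_lower (hlt k) hm (fun x hx => hu x (hI k x hx))
      (fun x hx => hu' x (hI k x hx)) (fun x hx => hqk x hx.1) (hzero k) (hzero _) (hne k)
  have upper : ∀ m > 0, ∀ k, (∀ x, z k < x → m ^ 2 < q x) → z (k + 1) - z k ≤ Real.pi / m :=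
    fun m hm k hqk => sturm_gap_upper hm (fun x hx => hu x (hI k x hx))
      (fun x hx => hu' x (hI k x hx)) (fun x hx => hqk x hx.1) (hzero k) (hne k)
  have hz : Tendsto z atTop atTop := by
    obtain ⟨B, hB⟩ := hqb (z 0) (hpos 0)
    set m := |B| + 1
    have hm0 : 0 < m := by positivity
    have hBm : B < m ^ 2 := by nlinarith [abs_nonneg B, le_abs_self B]
    have hgrow : ∀ k : ℕ, z 0 + k * (Real.pi / m) ≤ z k := fun k => by
      induction k with
      | zero => simp
      | succ k ih =>
        have := lower m hm0 k fun x hx => (hB (mem_image_of_mem q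
          ((hmono.monotone (Nat.zero_le k)).trans hx.le))).trans_lt hBm
        push_cast
        linarith
    exact tendsto_atTop_mono hgrow (tendsto_atTop_add_const_left _ _
      (tendsto_natCast_atTop_atTop.atTop_mul_const (div_pos Real.pi_pos hm0)))
  have hcont : Tendsto (fun m : ℝ => Real.pi / m) (𝓝 1) (𝓝 Real.pi) := by
    have : ContinuousAt (fun m : ℝ => Real.pi / m) 1 :=
      continuousAt_const.div continuousAt_id one_ne_zero
    simpa [ContinuousAt] using this
  refine tendsto_order.2 ⟨fun l hl => ?_, fun l hl => ?_⟩
  · obtain ⟨m, hm, hm1⟩ := (((hcont.eventually_const_lt hl).filter_mono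
      (nhdsWithin_le_nhds (s := Ioi 1))).and self_mem_nhdsWithin).exists
    have hm1 : 1 < m := hm1
    obtain ⟨X, hX⟩ := eventually_atTop.1 (hq.eventually_lt_const (one_lt_pow₀ hm1 two_ne_zero))
    filter_upwards [hz.eventually_ge_atTop X] with k hk
    exact hm.trans_le (lower m (by linarith) k fun x hx => hX x (hk.trans hx.le))
  · obtain ⟨m, ⟨hm, hm0⟩, hm1⟩ := (((((hcont.eventually_lt_const hl).and
      (lt_mem_nhds one_pos)).filter_mono
      (nhdsWithin_le_nhds (s := Iio 1)))).and self_mem_nhdsWithin).exists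
    have hm1 : m < 1 := hm1
    obtain ⟨X, hX⟩ := eventually_atTop.1
      (hq.eventually_const_lt (pow_lt_one₀ hm0.le hm1 two_ne_zero))
    filter_upwards [hz.eventually_ge_atTop X] with k hk
    exact (upper m hm0 k fun x hx => hX x (hk.trans hx.le)).trans_lt hm

end Sturm

section Counting

theorem tendsto_div_of_tendsto_sub {z : ℕ → ℝ} {l : ℝ}
    (hgap : Tendsto (fun k => z (k + 1) - z k) atTop (𝓝 l)) :
    Tendsto (fun n : ℕ => z n / n) atTop (𝓝 l) := by
  have h := hgap.cesaro.add (tendsto_const_div_atTop_nhds_zero_nat (z 0))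
  rw [add_zero] at h
  refine h.congr fun n => ?_
  rw [Finset.sum_range_sub]
  ring

/-- A strictly increasing sequence whose gaps tend to `l > 0` has counting function
asymptotic to `T / l`. -/
theorem tendsto_card_le_div {z : ℕ → ℝ} {l : ℝ} (hmono : StrictMono z) (hl : 0 < l)
    (hgap : Tendsto (fun k => z (k + 1) - z k) atTop (𝓝 l)) :
    Tendsto (fun T : ℝ => (Nat.card {k : ℕ | z k ≤ T} : ℝ) / T) atTop (𝓝 l⁻¹) := by
  have hdiv := tendsto_div_of_tendsto_sub hgap
  have hz : Tendsto z atTop atTop := by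
    refine (hdiv.pos_mul_atTop hl tendsto_natCast_atTop_atTop).congr' ?_
    filter_upwards [eventually_ne_atTop 0] with n hn
    field_simp
  have hdiv' : Tendsto (fun n : ℕ => z (n - 1) / n) atTop (𝓝 l) := by
    rw [← tendsto_add_atTop_iff_nat 1]
    have h := ((tendsto_add_atTop_iff_nat 1).2 hdiv).sub
      (hgap.mul ((tendsto_add_atTop_iff_nat 1).2 tendsto_inv_atTop_nhds_zero_nat))
    simp only [mul_zero, sub_zero] at h
    refine h.congr fun n => ?_
    simp only [Nat.add_sub_cancel]
    ring
  have hex : ∀ T, ∃ k, T < z k := fun T => (hz.eventually_gt_atTop T).exists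
  have hcard : ∀ T, Nat.card {k : ℕ | z k ≤ T} = Nat.find (hex T) := fun T => by
    have : {k : ℕ | z k ≤ T} = Iio (Nat.find (hex T)) := by
      ext k
      simp only [mem_ofPred_eq, mem_Iio, Nat.lt_find_iff, not_lt]
      exact ⟨fun h i hi => (hmono.monotone hi).trans h, fun h => h k le_rfl⟩
    rw [this]
    simp
  simp only [hcard]
  have hn : Tendsto (fun T => Nat.find (hex T)) atTop atTop := by
    refine tendsto_atTop.2 fun n => ?_
    filter_upwards [eventually_ge_atTop (z n)] with T hT
    exact (Nat.le_find_iff _ _).2 fun i hi => not_lt.2 ((hmono hi).le.trans hT)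
  have hmain : Tendsto (fun T : ℝ => T / (Nat.find (hex T) : ℝ)) atTop (𝓝 l) := by
    refine tendsto_of_tendsto_of_tendsto_of_le_of_le' (hdiv'.comp hn) (hdiv.comp hn) ?_ ?_
    · filter_upwards [hn.eventually_ge_atTop 1] with T hT
      have := not_lt.1 (Nat.find_min (hex T) (m := Nat.find (hex T) - 1) (by omega))
      simp only [Function.comp_apply]
      gcongr
    · filter_upwards with T
      have := (Nat.find_spec (hex T)).le
      simp only [Function.comp_apply]
      gcongr
  refine (hmain.inv₀ hl.ne').congr fun T => ?_
  rw [inv_div]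

end Counting

section Bessel

variable {α : ℝ}

/-- The coefficients of the entire function `t ↦ t^(-α/2) J_α(2√t)`. -/
noncomputable def besselCoeff (α : ℝ) (k : ℕ) : ℝ :=
  (-1 : ℝ) ^ k / (Nat.factorial k * Real.Gamma ((k : ℝ) + α + 1))

theorem gamma_add_one_le_gamma_natCast_add (hα : 0 ≤ α) (k : ℕ) :
    Real.Gamma (α + 1) ≤ Real.Gamma ((k : ℝ) + α + 1) := by
  induction k with
  | zero => simp
  | succ k ih =>
    have h : Real.Gamma (((k + 1 : ℕ) : ℝ) + α + 1)
        = ((k : ℝ) + α + 1) * Real.Gamma ((k : ℝ) + α + 1) := by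
      rw [← Real.Gamma_add_one (by positivity)]
      push_cast
      ring_nf
    have hpos : 0 < Real.Gamma ((k : ℝ) + α + 1) := Real.Gamma_pos_of_pos (by positivity)
    rw [h]
    nlinarith [(Nat.cast_nonneg k : (0 : ℝ) ≤ k)]

theorem summable_besselCoeff_mul_pow (hα : 0 ≤ α) (r : ℝ) :
    Summable fun k => besselCoeff α k * r ^ k := by
  have hΓ : 0 < Real.Gamma (α + 1) := Real.Gamma_pos_of_pos (by positivity)
  refine Summable.of_norm_bounded
    ((Real.summable_pow_div_factorial |r|).mul_left (Real.Gamma (α + 1))⁻¹) fun k => ?_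
  have hk := gamma_add_one_le_gamma_natCast_add hα k
  have hk0 : 0 < Real.Gamma ((k : ℝ) + α + 1) := hΓ.trans_le hk
  simp only [besselCoeff, norm_mul, norm_div, norm_pow, Real.norm_eq_abs, abs_neg, abs_one,
    one_pow, Nat.abs_cast]
  rw [abs_of_pos hk0, one_div, mul_inv, div_eq_mul_inv]
  calc _ = (Real.Gamma ((k : ℝ) + α + 1))⁻¹ * (|r| ^ k * ((Nat.factorial k : ℝ))⁻¹) := by ring
    _ ≤ _ := by gcongr

theorem besselCoeff_succ (hα : 0 ≤ α) (k : ℕ) :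
    ((k : ℝ) + 1) * (k + α + 1) * besselCoeff α (k + 1) = -besselCoeff α k := by
  have h : Real.Gamma (((k + 1 : ℕ) : ℝ) + α + 1)
      = ((k : ℝ) + α + 1) * Real.Gamma ((k : ℝ) + α + 1) := by
    rw [← Real.Gamma_add_one (by positivity)]
    push_cast
    ring_nf
  have hpos : 0 < Real.Gamma ((k : ℝ) + α + 1) := Real.Gamma_pos_of_pos (by positivity)
  have hk : (k : ℝ) + α + 1 ≠ 0 := by positivity
  have hf : (Nat.factorial k : ℝ) ≠ 0 := by positivity
  simp only [besselCoeff, h, Nat.factorial_succ, pow_succ]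
  push_cast
  field_simp

theorem besselJ_eq_rpow_mul_tsum {x : ℝ} (hx : 0 < x) :
    besselJ α x = (x / 2) ^ α * ∑' k, besselCoeff α k * (x ^ 2 / 4) ^ k := by
  rw [besselJ, ← tsum_mul_left]
  refine tsum_congr fun k => ?_
  have hx2 : 0 < x / 2 := by positivity
  have h : (x / 2) ^ (2 * (k : ℝ)) = (x ^ 2 / 4) ^ k := by
    rw [Real.rpow_mul hx2.le, Real.rpow_natCast]
    congr 1
    rw [Real.rpow_two]
    ring
  rw [Real.rpow_add hx2, h, besselCoeff]
  ring

/-- The function `√x J_α(x)`, up to a constant factor, satisfies the Bessel equation in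
normal form `u'' = -(1 + (1/4 - α²) / x²) u`. -/
theorem exists_bessel_normal_form (hα : 0 ≤ α) : ∃ u u' : ℝ → ℝ,
    (∀ x, 0 < x → HasDerivAt u (u' x) x) ∧
    (∀ x, 0 < x → HasDerivAt u' (-(1 + (1 / 4 - α ^ 2) / x ^ 2) * u x) x) ∧
    ∀ x, 0 < x → (u x = 0 ↔ besselJ α x = 0) := by
  have hc := summable_besselCoeff_mul_pow hα
  have hc' := summable_succ_mul_coeff_succ_mul_pow hc
  have hf := hasDerivAt_tsum_coeff_mul_pow hc
  have hf' := hasDerivAt_tsum_coeff_mul_pow hc'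
  have hode : ∀ t : ℝ,
      t * (∑' k : ℕ, ((k + 1 : ℝ) * (((k + 1 : ℕ) + 1 : ℝ) * besselCoeff α (k + 1 + 1))) * t ^ k)
      = -(α + 1) * (∑' k : ℕ, ((k + 1 : ℝ) * besselCoeff α (k + 1)) * t ^ k)
        - ∑' k, besselCoeff α k * t ^ k := fun t => by
    have hshift : t * (∑' k : ℕ,
        ((k + 1 : ℝ) * (((k + 1 : ℕ) + 1 : ℝ) * besselCoeff α (k + 1 + 1))) * t ^ k)
        = ∑' k : ℕ, (k * ((k + 1 : ℝ) * besselCoeff α (k + 1))) * t ^ k := by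
      have hs : Summable fun k : ℕ => (k * ((k + 1 : ℝ) * besselCoeff α (k + 1))) * t ^ k := by
        refine (summable_nat_add_iff 1).1 (((summable_succ_mul_coeff_succ_mul_pow hc' t).mul_left
          t).congr fun k => ?_)
        push_cast
        ring
      rw [hs.tsum_eq_zero_add, ← tsum_mul_left]
      simp only [Nat.cast_zero, zero_mul, zero_add]
      refine tsum_congr fun k => ?_
      push_cast
      ring
    rw [hshift, ← tsum_mul_left, ← ((hc' t).mul_left _).tsum_sub (hc t)]
    refine tsum_congr fun k => ?_
    linear_combination t ^ k * besselCoeff_succ hα k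
  set f : ℝ → ℝ := fun t => ∑' k, besselCoeff α k * t ^ k with hfdef
  set f₁ : ℝ → ℝ := fun t => ∑' k : ℕ, ((k + 1 : ℝ) * besselCoeff α (k + 1)) * t ^ k
  set f₂ : ℝ → ℝ := fun t => ∑' k : ℕ,
    ((k + 1 : ℝ) * (((k + 1 : ℕ) + 1 : ℝ) * besselCoeff α (k + 1 + 1))) * t ^ k
  set s := α + 1 / 2 with hs
  have hsq : ∀ x : ℝ, HasDerivAt (fun x => x ^ 2 / 4) (x / 2) x := fun x => by
    refine HasDerivAt.congr_deriv ((hasDerivAt_pow 2 x).div_const 4) ?_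
    push_cast
    ring
  have hg : ∀ x : ℝ, HasDerivAt (fun x => f (x ^ 2 / 4)) (f₁ (x ^ 2 / 4) * (x / 2)) x :=
    fun x => HasDerivAt.comp (h₂ := f) x (hf (x ^ 2 / 4)) (hsq x)
  have hg₁ : ∀ x : ℝ, HasDerivAt (fun x => f₁ (x ^ 2 / 4)) (f₂ (x ^ 2 / 4) * (x / 2)) x :=
    fun x => HasDerivAt.comp (h₂ := f₁) x (hf' (x ^ 2 / 4)) (hsq x)
  have hpow : ∀ r x : ℝ, 0 < x → HasDerivAt (fun x : ℝ => x ^ r) (r * x ^ (r - 1)) x :=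
    fun r x hx => Real.hasDerivAt_rpow_const (Or.inl hx.ne')
  refine ⟨fun x => x ^ s * f (x ^ 2 / 4),
    fun x => s * x ^ (s - 1) * f (x ^ 2 / 4) + x ^ s * (f₁ (x ^ 2 / 4) * (x / 2)),
    fun x hx => (hpow s x hx).mul (hg x), fun x hx => ?_, fun x hx => ?_⟩
  · refine HasDerivAt.congr_deriv ((((hpow (s - 1) x hx).const_mul s).mul (hg x)).add
      ((hpow s x hx).mul ((hg₁ x).mul ((hasDerivAt_id x).div_const 2)))) ?_
    have h := hode (x ^ 2 / 4)
    rw [Real.rpow_sub_one hx.ne', Real.rpow_sub_one hx.ne']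
    simp only
    field_simp
    rw [hs]
    linear_combination 16 * x ^ 2 * h
  · rw [besselJ_eq_rpow_mul_tsum hx]
    have h1 : x ^ s ≠ 0 := (Real.rpow_pos_of_pos hx s).ne'
    have h2 : (x / 2) ^ α ≠ 0 := (Real.rpow_pos_of_pos (by positivity) α).ne'
    simp [h1, h2, hfdef]

theorem tendsto_besselJ_zero_gap (hα : 0 ≤ α) {j : ℕ → ℝ} (hmono : StrictMono j)
    (hpos : ∀ k, 0 < j k) (hzero : ∀ k, besselJ α (j k) = 0)
    (hall : ∀ x : ℝ, 0 < x → besselJ α x = 0 → ∃ k, x = j k) :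
    Tendsto (fun k => j (k + 1) - j k) atTop (𝓝 Real.pi) := by
  obtain ⟨u, u', hu, hu', h0⟩ := exists_bessel_normal_form hα
  refine tendsto_zero_gap_of_tendsto_one hmono hpos hu hu' ?_ ?_
    (fun k => (h0 _ (hpos k)).2 (hzero k)) (fun x hx h => hall x hx ((h0 x hx).1 h))
  · have h : Tendsto (fun x : ℝ => (1 / 4 - α ^ 2) / x ^ 2) atTop (𝓝 0) :=
      tendsto_const_nhds.div_atTop (tendsto_pow_atTop two_ne_zero)
    simpa using h.const_add 1
  · rintro ε hε
    refine ⟨1 + (1 / 4) / ε ^ 2, ?_⟩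
    rintro _ ⟨x, hx, rfl⟩
    have hx : ε ≤ x := hx
    have h1 : (1 / 4 - α ^ 2) / x ^ 2 ≤ (1 / 4) / x ^ 2 := by
      gcongr
      nlinarith
    have h2 : (1 / 4 : ℝ) / x ^ 2 ≤ (1 / 4) / ε ^ 2 := by gcongr
    simp only
    linarith

end Bessel

theorem stmt19 (α a : ℝ) (hα : 0 ≤ α) (ha : 0 < a)
    (j : ℕ → ℝ) (hmono : StrictMono j) (hpos : ∀ k, 0 < j k)
    (hzero : ∀ k, besselJ α (j k) = 0)
    (hall : ∀ x : ℝ, 0 < x → besselJ α x = 0 → ∃ k, x = j k)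
    (b : ℝ) (hb : b < 0) :
    Filter.Tendsto (fun N : ℕ =>
        (1 / N : ℝ) * Nat.card {k : ℕ | b ≤ -((j k / (2 * Real.sqrt a * N)) ^ 2)})
      Filter.atTop (nhds ((2 / Real.pi) * Real.sqrt (a * |b|))) := by
  have hb' : 0 < Real.sqrt |b| := Real.sqrt_pos.2 (abs_pos.2 hb.ne)
  have hT : 0 < 2 * Real.sqrt a * Real.sqrt |b| := by positivity
  have h := ((tendsto_card_le_div hmono Real.pi_pos
    (tendsto_besselJ_zero_gap hα hmono hpos hzero hall)).comp
    (tendsto_natCast_atTop_atTop.const_mul_atTop hT)).const_mul (2 * Real.sqrt a * Real.sqrt |b|)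
  have hlim : 2 / Real.pi * Real.sqrt (a * |b|)
      = 2 * Real.sqrt a * Real.sqrt |b| * Real.pi⁻¹ := by
    rw [Real.sqrt_mul ha.le]
    ring
  rw [hlim]
  refine h.congr' ?_
  filter_upwards [Filter.eventually_gt_atTop 0] with N hN
  have hN' : (0 : ℝ) < N := by exact_mod_cast hN
  have hset : {k : ℕ | b ≤ -((j k / (2 * Real.sqrt a * N)) ^ 2)}
      = {k : ℕ | j k ≤ 2 * Real.sqrt a * Real.sqrt |b| * N} := by
    ext k
    have hden : 0 < 2 * Real.sqrt a * N := by positivity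
    simp only [Set.mem_ofPred_eq]
    rw [le_neg, ← abs_of_neg hb, ← Real.le_sqrt' (div_pos (hpos k) hden), div_le_iff₀ hden,
      show Real.sqrt |b| * (2 * Real.sqrt a * N) = 2 * Real.sqrt a * Real.sqrt |b| * N by ring]
  rw [hset]
  simp only [Function.comp_apply]
  field_simp
end
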